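/- Let u ∈ A₁ and v ∈ A₁ be weights on ℝⁿ. Then there is a dimensional constant c_n such that for every f ∈ L¹(uv): ‖M(fv)/v‖_{L^{1,∞}(uv)} ≤ c_n [u]_{A₁} [v]_{A_∞} ( [u]_{A₁}[v]_{A_∞} + 1 + log [v]_{A₁} ) ‖f‖_{L¹(uv)}. -/

import Mathlib

open MeasureTheory ENNReal NNReal

noncomputable section

/-- An axis-parallel cube in `ℝⁿ`. -/
def IsCube {n : ℕ} (Q : Set (Fin n → ℝ)) : Prop :=
  ∃ (a : Fin n → ℝ) (h : ℝ), 0 < h ∧ Q = {x | ∀ i, a i ≤ x i ∧ x i ≤ a i + h}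

/-- Average `(1/|Q|) ∫_Q f` of an `ℝ≥0∞`-valued function over a set. -/
def cubeAvg {n : ℕ} (f : (Fin n → ℝ) → ℝ≥0∞) (Q : Set (Fin n → ℝ)) : ℝ≥0∞ :=
  (∫⁻ x in Q, f x) / MeasureTheory.volume Q

/-- The uncentered Hardy–Littlewood maximal operator over axis-parallel cubes,
for `ℝ≥0∞`-valued functions. -/
def hlM {n : ℕ} (f : (Fin n → ℝ) → ℝ≥0∞) (x : Fin n → ℝ) : ℝ≥0∞ :=
  ⨆ (Q : Set (Fin n → ℝ)) (_ : IsCube Q) (_ : x ∈ Q), cubeAvg f Q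

/-- The Hardy–Littlewood maximal operator applied to a real-valued function:
`Mf(x) = sup_{Q ∋ x} (1/|Q|) ∫_Q |f|`. -/
def hlMR {n : ℕ} (f : (Fin n → ℝ) → ℝ) : (Fin n → ℝ) → ℝ≥0∞ :=
  hlM (fun y => ENNReal.ofReal |f y|)

/-- A weight: a locally integrable, a.e. positive function. -/
def IsWeight {n : ℕ} (w : (Fin n → ℝ) → ℝ) : Prop :=
  MeasureTheory.LocallyIntegrable w MeasureTheory.volume ∧
    ∀ᵐ x ∂(MeasureTheory.volume : MeasureTheory.Measure (Fin n → ℝ)), 0 < w x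

/-- `w(E) = ∫_E w dx`. -/
def wMeas {n : ℕ} (w : (Fin n → ℝ) → ℝ) (E : Set (Fin n → ℝ)) : ℝ≥0∞ :=
  ∫⁻ x in E, ENNReal.ofReal (w x)

/-- The `A₁` constant `[w]_{A₁} = ess sup_x M w(x) / w(x)`. -/
def a1Const {n : ℕ} (w : (Fin n → ℝ) → ℝ) : ℝ≥0∞ :=
  essSup (fun x => hlM (fun y => ENNReal.ofReal (w y)) x / ENNReal.ofReal (w x))
    MeasureTheory.volume

/-- The Fujii–Wilson `A_∞` constant `[w]_{A_∞} = sup_Q (1/∫_Q w) ∫_Q M(w·1_Q)`. -/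
def aInfConst {n : ℕ} (w : (Fin n → ℝ) → ℝ) : ℝ≥0∞ :=
  ⨆ (Q : Set (Fin n → ℝ)) (_ : IsCube Q),
    (∫⁻ x in Q, hlM (Q.indicator fun y => ENNReal.ofReal (w y)) x) / wMeas w Q

/-- The `A_p` constant, `1 < p < ∞`:
`[w]_{A_p} = sup_Q ⟨w⟩_Q (⟨w^{-1/(p-1)}⟩_Q)^{p-1}`. -/
def apConst {n : ℕ} (p : ℝ) (w : (Fin n → ℝ) → ℝ) : ℝ≥0∞ :=
  ⨆ (Q : Set (Fin n → ℝ)) (_ : IsCube Q),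
    cubeAvg (fun y => ENNReal.ofReal (w y)) Q *
      (cubeAvg (fun y => ENNReal.ofReal (w y) ^ (-(1 / (p - 1)))) Q) ^ (p - 1)

/-- The weak norm `‖g‖_{L^{1,∞}(σ)} = sup_{t>0} t · σ({x : g(x) > t})`
for an `ℝ≥0∞`-valued function `g` and a weight `σ`. -/
def wkNorm {n : ℕ} (g : (Fin n → ℝ) → ℝ≥0∞) (σ : (Fin n → ℝ) → ℝ) : ℝ≥0∞ :=
  ⨆ (t : ℝ≥0) (_ : 0 < t), (t : ℝ≥0∞) * wMeas σ {x | (t : ℝ≥0∞) < g x}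

/-- `‖f‖_{L¹(σ)} = ∫ |f| σ dx`. -/
def l1Norm {n : ℕ} (f : (Fin n → ℝ) → ℝ) (σ : (Fin n → ℝ) → ℝ) : ℝ≥0∞ :=
  ∫⁻ x, ENNReal.ofReal |f x| * ENNReal.ofReal (σ x)

/-- `‖g‖_{L^p(σ)} = (∫ g^p σ dx)^{1/p}` for an `ℝ≥0∞`-valued `g`. -/
def lpNormE {n : ℕ} (p : ℝ) (g : (Fin n → ℝ) → ℝ≥0∞) (σ : (Fin n → ℝ) → ℝ) : ℝ≥0∞ :=
  (∫⁻ x, g x ^ p * ENNReal.ofReal (σ x)) ^ (1 / p)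

/-- A bounded, compactly supported measurable function. -/
def BddCompSupp {n : ℕ} (f : (Fin n → ℝ) → ℝ) : Prop :=
  Measurable f ∧ (∃ C : ℝ, ∀ x, |f x| ≤ C) ∧ HasCompactSupport f

end

/-- A nested sequence of countable partitions of a measure space into cells of positive finite
measure, in which every cell has at most `N` times the measure of each of its children. -/
structure CellSystem {X : Type*} [MeasurableSpace X] (μ : Measure X) (N : ℝ≥0∞) (κ : Type*) where
  /-- The label of the cell of a given generation that contains a given point. -/
  idx : ℕ → X → κ
  measurableSet_fiber : ∀ j k, MeasurableSet {x | idx j x = k}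
  nested : ∀ j x y, idx (j + 1) x = idx (j + 1) y → idx j x = idx j y
  measure_ne_zero : ∀ j k, μ {x | idx j x = k} ≠ 0
  measure_ne_top : ∀ j k, μ {x | idx j x = k} ≠ ∞
  doubling : ∀ j k k', {x | idx (j + 1) x = k'} ⊆ {x | idx j x = k} →
    μ {x | idx j x = k} ≤ N * μ {x | idx (j + 1) x = k'}

namespace CellSystem

variable {X κ : Type*} [MeasurableSpace X] {μ : Measure X} {N : ℝ≥0∞} (D : CellSystem μ N κ)

/-- The cell with a given generation and label. -/
def cell (q : ℕ × κ) : Set X := {x | D.idx q.1 x = q.2}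

/-- The average of a function over a cell. -/
noncomputable def avg (f : X → ℝ≥0∞) (q : ℕ × κ) : ℝ≥0∞ := (∫⁻ x in D.cell q, f x ∂μ) / μ (D.cell q)

/-- The cell `q` is a descendant of the cell `p`. -/
def Below (q p : ℕ × κ) : Prop := p.1 ≤ q.1 ∧ D.cell q ⊆ D.cell p

/-- The cell `q` has the property `P`, and none of its strict ancestors has it. -/
def IsMax (P : ℕ × κ → Prop) (q : ℕ × κ) : Prop :=
  P q ∧ ∀ p, p.1 < q.1 → D.cell q ⊆ D.cell p → ¬ P p

/-- The union of the cells with the property `P`. -/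
def cover (P : ℕ × κ → Prop) : Set X := {x | ∃ q, P q ∧ x ∈ D.cell q}

lemma mem_cell_idx (j : ℕ) (x : X) : x ∈ D.cell (j, D.idx j x) := rfl

lemma measurableSet_cell (q : ℕ × κ) : MeasurableSet (D.cell q) := D.measurableSet_fiber q.1 q.2

lemma measure_cell_ne_zero (q : ℕ × κ) : μ (D.cell q) ≠ 0 := D.measure_ne_zero q.1 q.2

lemma measure_cell_ne_top (q : ℕ × κ) : μ (D.cell q) ≠ ∞ := D.measure_ne_top q.1 q.2

lemma cell_nonempty (q : ℕ × κ) : (D.cell q).Nonempty :=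
  nonempty_of_measure_ne_zero (D.measure_cell_ne_zero q)

lemma idx_eq_of_le {i j : ℕ} (hij : i ≤ j) {x y : X} (h : D.idx j x = D.idx j y) :
    D.idx i x = D.idx i y := by
  induction j, hij using Nat.le_induction with
  | base => exact h
  | succ j _ ih => exact ih (D.nested j x y h)

lemma cell_subset_of_mem {p q : ℕ × κ} (hpq : p.1 ≤ q.1) {x : X} (hp : x ∈ D.cell p)
    (hq : x ∈ D.cell q) : D.cell q ⊆ D.cell p := by
  intro y hy
  have hy' : D.idx q.1 y = D.idx q.1 x := Eq.trans hy (Eq.symm hq)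
  exact (D.idx_eq_of_le hpq hy').trans hp

lemma eq_of_mem {p q : ℕ × κ} (hpq : p.1 = q.1) {x : X} (hp : x ∈ D.cell p)
    (hq : x ∈ D.cell q) : p = q := by
  obtain ⟨i, k⟩ := p
  obtain ⟨j, l⟩ := q
  obtain rfl : i = j := hpq
  have : k = l := Eq.trans (Eq.symm hp) hq
  rw [this]

lemma Below.refl (q : ℕ × κ) : D.Below q q := ⟨le_rfl, subset_rfl⟩

lemma Below.trans {q p r : ℕ × κ} (h : D.Below q p) (h' : D.Below p r) : D.Below q r :=
  ⟨h'.1.trans h.1, h.2.trans h'.2⟩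

lemma exists_isMax {P : ℕ × κ → Prop} {q : ℕ × κ} (hq : P q) :
    ∃ p, D.IsMax P p ∧ D.Below q p := by
  obtain ⟨j, hj⟩ : ∃ j, q.1 = j := ⟨_, rfl⟩
  induction j using Nat.strong_induction_on generalizing q with
  | _ j ih =>
    by_cases h : ∃ p : ℕ × κ, p.1 < q.1 ∧ D.cell q ⊆ D.cell p ∧ P p
    · obtain ⟨p, h1, h2, h3⟩ := h
      obtain ⟨r, hr, hr'⟩ := ih p.1 (hj ▸ h1) h3 rfl
      exact ⟨r, hr, Below.trans D ⟨h1.le, h2⟩ hr'⟩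
    · push Not at h
      exact ⟨q, ⟨hq, h⟩, Below.refl D q⟩

lemma IsMax.eq_of_mem {P : ℕ × κ → Prop} {p q : ℕ × κ} (hp : D.IsMax P p) (hq : D.IsMax P q)
    {x : X} (hxp : x ∈ D.cell p) (hxq : x ∈ D.cell q) : p = q := by
  rcases lt_trichotomy p.1 q.1 with h | h | h
  · exact absurd hp.1 (hq.2 p h (D.cell_subset_of_mem h.le hxp hxq))
  · exact D.eq_of_mem h hxp hxq
  · exact absurd hq.1 (hp.2 q h (D.cell_subset_of_mem h.le hxq hxp))

lemma cover_eq_iUnion_isMax (P : ℕ × κ → Prop) :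
    D.cover P = ⋃ q : {q // D.IsMax P q}, D.cell q := by
  ext x
  simp only [cover, Set.mem_ofPred_eq, Set.mem_iUnion, Subtype.exists, exists_prop]
  constructor
  · rintro ⟨q, hq, hx⟩
    obtain ⟨p, hp, hqp⟩ := D.exists_isMax hq
    exact ⟨p, hp, hqp.2 hx⟩
  · rintro ⟨q, hq, hx⟩
    exact ⟨q, hq.1, hx⟩

lemma pairwise_disjoint_isMax (P : ℕ × κ → Prop) :
    Pairwise (Function.onFun Disjoint fun q : {q // D.IsMax P q} => D.cell q) := by
  intro p q hpq
  refine Set.disjoint_left.2 fun x hxp hxq => hpq ?_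
  exact Subtype.ext (p.2.eq_of_mem D q.2 hxp hxq)

section Countable

variable [Countable κ]

lemma measurableSet_cover (P : ℕ × κ → Prop) : MeasurableSet (D.cover P) := by
  rw [cover_eq_iUnion_isMax]
  exact MeasurableSet.iUnion fun q => D.measurableSet_cell q

lemma lintegral_cover (P : ℕ × κ → Prop) (f : X → ℝ≥0∞) :
    ∫⁻ x in D.cover P, f x ∂μ = ∑' q : {q // D.IsMax P q}, ∫⁻ x in D.cell q, f x ∂μ := by
  rw [cover_eq_iUnion_isMax]
  exact lintegral_iUnion (fun q : {q // D.IsMax P q} => D.measurableSet_cell q)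
    (D.pairwise_disjoint_isMax P) f

lemma measure_cover (P : ℕ × κ → Prop) :
    μ (D.cover P) = ∑' q : {q // D.IsMax P q}, μ (D.cell q) := by
  simpa using D.lintegral_cover P 1

end Countable

lemma avg_mul_measure (f : X → ℝ≥0∞) (q : ℕ × κ) :
    D.avg f q * μ (D.cell q) = ∫⁻ x in D.cell q, f x ∂μ :=
  ENNReal.div_mul_cancel (D.measure_cell_ne_zero q) (D.measure_cell_ne_top q)

lemma avg_mul_lintegral (f g : X → ℝ≥0∞) (q : ℕ × κ) :
    D.avg f q * ∫⁻ x in D.cell q, g x ∂μ = D.avg g q * ∫⁻ x in D.cell q, f x ∂μ := by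
  simp only [avg, div_eq_mul_inv]
  ring

lemma measure_cover_le [Countable κ] {P : ℕ × κ → Prop} {f : X → ℝ≥0∞} {l : ℝ≥0∞}
    (hP : ∀ q, P q → l ≤ D.avg f q) : l * μ (D.cover P) ≤ ∫⁻ x in D.cover P, f x ∂μ := by
  rw [D.measure_cover, D.lintegral_cover, ← ENNReal.tsum_mul_left]
  refine ENNReal.tsum_le_tsum fun q => ?_
  rw [← D.avg_mul_measure]
  gcongr
  exact hP q q.2.1

lemma exists_parent {q : ℕ × κ} (hq : 0 < q.1) :
    ∃ p : ℕ × κ, p.1 + 1 = q.1 ∧ D.cell q ⊆ D.cell p := by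
  obtain ⟨x, hx⟩ := D.cell_nonempty q
  refine ⟨(q.1 - 1, D.idx (q.1 - 1) x), by simp; omega, ?_⟩
  exact D.cell_subset_of_mem (by simp) (D.mem_cell_idx _ x) hx

lemma avg_le_parent (f : X → ℝ≥0∞) {p q : ℕ × κ} (h : p.1 + 1 = q.1)
    (hs : D.cell q ⊆ D.cell p) : D.avg f q ≤ N * D.avg f p := by
  obtain ⟨i, k⟩ := p
  obtain ⟨j, l⟩ := q
  obtain rfl : i + 1 = j := h
  have h1 : μ (D.cell (i, k)) ≤ N * μ (D.cell (i + 1, l)) := D.doubling i k l hs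
  rw [avg, ENNReal.div_le_iff (D.measure_cell_ne_zero _) (D.measure_cell_ne_top _)]
  calc ∫⁻ x in D.cell (i + 1, l), f x ∂μ ≤ ∫⁻ x in D.cell (i, k), f x ∂μ := lintegral_mono_set hs
    _ = D.avg f (i, k) * μ (D.cell (i, k)) := (D.avg_mul_measure _ _).symm
    _ ≤ D.avg f (i, k) * (N * μ (D.cell (i + 1, l))) := by gcongr
    _ = _ := by ring

/-- A cell on which the average of `f` is at most `N * l` is filled at most half by its
descendants on which the average exceeds `2 * N * l`. -/
lemma measure_cover_le_half [Countable κ] {P : ℕ × κ → Prop} {f : X → ℝ≥0∞} {l : ℝ≥0∞}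
    {q : ℕ × κ} (hl : l ≠ 0) (hl' : l ≠ ∞) (hN : N ≠ 0) (hN' : N ≠ ∞) (hq : D.avg f q ≤ N * l)
    (hP : ∀ p, P p → D.Below p q) (hP' : ∀ p, P p → 2 * N * l ≤ D.avg f p) :
    2 * μ (D.cover P) ≤ μ (D.cell q) := by
  have hs : D.cover P ⊆ D.cell q := fun x ⟨p, hp, hx⟩ => (hP p hp).2 hx
  have h1 : N * l * (2 * μ (D.cover P)) ≤ N * l * μ (D.cell q) :=
    calc N * l * (2 * μ (D.cover P)) = 2 * N * l * μ (D.cover P) := by ring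
      _ ≤ ∫⁻ x in D.cover P, f x ∂μ := D.measure_cover_le hP'
      _ ≤ ∫⁻ x in D.cell q, f x ∂μ := lintegral_mono_set hs
      _ = D.avg f q * μ (D.cell q) := (D.avg_mul_measure _ _).symm
      _ ≤ _ := by gcongr
  exact (ENNReal.mul_le_mul_iff_right (mul_ne_zero hN hl) (ENNReal.mul_ne_top hN' hl')).1 h1

lemma measure_le_two_mul_diff {s t : Set X} (ht : MeasurableSet t) (hs : μ s ≠ ∞) (hst : t ⊆ s)
    (h : 2 * μ t ≤ μ s) : μ s ≤ 2 * μ (s \ t) := by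
  have h1 : μ s = μ t + μ (s \ t) := by
    rw [← measure_inter_add_sdiff s ht, Set.inter_eq_self_of_subset_right hst]
  have ht' : μ t ≠ ∞ := ne_top_of_le_ne_top hs (measure_mono hst)
  have h2 : μ t ≤ μ (s \ t) := by
    rw [h1, two_mul] at h
    exact (ENNReal.add_le_add_iff_left ht').1 h
  rw [h1, two_mul]
  gcongr

/-- If the averages of `U` are bounded by `A * U`, a subset filling at most half of a cell carries
a proportion of at most `1 - (2 * A)⁻¹` of the `U`-mass of the cell. -/
lemma lintegral_le_of_half {U : X → ℝ≥0∞} {A : ℝ≥0∞} (hA0 : A ≠ 0) (hA : A ≠ ∞)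
    (hU : Measurable U) (hfin : ∀ q, ∫⁻ x in D.cell q, U x ∂μ ≠ ∞)
    (hUA : ∀ᵐ x ∂μ, ∀ q, x ∈ D.cell q → D.avg U q ≤ A * U x) {q : ℕ × κ} {W : Set X}
    (hW : MeasurableSet W) (hWq : W ⊆ D.cell q) (h : 2 * μ W ≤ μ (D.cell q)) :
    ∫⁻ x in W, U x ∂μ ≤ (1 - (2 * A)⁻¹) * ∫⁻ x in D.cell q, U x ∂μ := by
  have h1 : ∫⁻ x in D.cell q, U x ∂μ ≤ 2 * A * ∫⁻ x in D.cell q \ W, U x ∂μ :=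
    calc ∫⁻ x in D.cell q, U x ∂μ = D.avg U q * μ (D.cell q) := (D.avg_mul_measure _ _).symm
      _ ≤ D.avg U q * (2 * μ (D.cell q \ W)) := by
        gcongr
        exact measure_le_two_mul_diff hW (D.measure_cell_ne_top q) hWq h
      _ = 2 * ∫⁻ x in D.cell q \ W, D.avg U q ∂μ := by
        rw [setLIntegral_const]; ring
      _ ≤ 2 * ∫⁻ x in D.cell q \ W, A * U x ∂μ := by
        gcongr 2 * ?_
        refine setLIntegral_mono_ae (by fun_prop) ?_
        filter_upwards [hUA] with x hx hxq using hx q hxq.1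
      _ = _ := by rw [lintegral_const_mul _ hU]; ring
  have h2 : ∫⁻ x in D.cell q, U x ∂μ = ∫⁻ x in W, U x ∂μ + ∫⁻ x in D.cell q \ W, U x ∂μ := by
    rw [← lintegral_inter_add_sdiff U (D.cell q) hW, Set.inter_eq_self_of_subset_right hWq]
  have h3 : (2 * A)⁻¹ * ∫⁻ x in D.cell q, U x ∂μ ≤ ∫⁻ x in D.cell q \ W, U x ∂μ := by
    rw [ENNReal.inv_mul_le_iff (by simpa using hA0) (ENNReal.mul_ne_top (by simp) hA)]
    exact h1
  have hd : ∫⁻ x in D.cell q \ W, U x ∂μ ≠ ∞ :=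
    ne_top_of_le_ne_top (hfin q) (lintegral_mono_set Set.sdiff_subset)
  rw [ENNReal.sub_mul (fun _ _ => hfin q), one_mul]
  calc ∫⁻ x in W, U x ∂μ
      = ∫⁻ x in D.cell q, U x ∂μ - ∫⁻ x in D.cell q \ W, U x ∂μ := by
        rw [h2, ENNReal.add_sub_cancel_right hd]
    _ ≤ _ := tsub_le_tsub_left h3 _

/-- Exponential decay of the `U`-mass of the super-level sets of the local maximal function
of `V`. -/
lemma lintegral_cover_le_pow [Countable κ] {U V : X → ℝ≥0∞} {A : ℝ≥0∞} (hN : 1 ≤ N) (hN' : N ≠ ∞)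
    (hA0 : A ≠ 0) (hA : A ≠ ∞)
    (hU : Measurable U) (hfin : ∀ q, ∫⁻ x in D.cell q, U x ∂μ ≠ ∞)
    (hUA : ∀ᵐ x ∂μ, ∀ q, x ∈ D.cell q → D.avg U q ≤ A * U x) (r : ℕ) :
    ∀ (q : ℕ × κ) (l : ℝ≥0∞), l ≠ 0 → l ≠ ∞ → D.avg V q ≤ N * l →
      ∫⁻ x in D.cover (fun p => D.Below p q ∧ (2 * N) ^ r * l < D.avg V p), U x ∂μ ≤
        (1 - (2 * A)⁻¹) ^ r * ∫⁻ x in D.cell q, U x ∂μ := by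
  have hN0 : N ≠ 0 := (zero_lt_one.trans_le hN).ne'
  induction r with
  | zero =>
    intro q l _ _ _
    simp only [pow_zero, one_mul]
    refine lintegral_mono_set ?_
    rintro x ⟨p, hp, hx⟩
    exact hp.1.2 hx
  | succ r ih =>
    intro q l hl hl' hq
    set P : ℕ × κ → Prop := fun p => D.Below p q ∧ 2 * N * l < D.avg V p with hP
    have hl2 : 2 * N * l ≠ 0 := mul_ne_zero (mul_ne_zero two_ne_zero hN0) hl
    have hl2' : 2 * N * l ≠ ∞ := ENNReal.mul_ne_top (ENNReal.mul_ne_top (by simp) hN') hl'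
    have h1N : (1 : ℝ≥0∞) ≤ 2 * N := by
      calc (1 : ℝ≥0∞) ≤ N := hN
        _ ≤ 2 * N := by rw [two_mul]; exact le_self_add
    have key : ∀ p, D.IsMax P p → D.avg V p ≤ N * (2 * N * l) := by
      intro p hp
      have hlt : q.1 < p.1 := by
        rcases hp.1.1.1.lt_or_eq with h | h
        · exact h
        · obtain ⟨x, hx⟩ := D.cell_nonempty p
          have := D.eq_of_mem h (hp.1.1.2 hx) hx
          subst this
          refine absurd (hp.1.2.trans_le hq) (not_lt.2 ?_)
          rw [mul_assoc, two_mul]; exact le_self_add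
      obtain ⟨p', hp', hpp'⟩ := D.exists_parent (pos_of_gt hlt)
      obtain ⟨x, hx⟩ := D.cell_nonempty p
      have hb : D.Below p' q :=
        ⟨by omega, D.cell_subset_of_mem (by omega) (hp.1.1.2 hx) (hpp' hx)⟩
      have hn := hp.2 p' (by omega) hpp'
      have : D.avg V p' ≤ 2 * N * l := not_lt.1 fun h => hn ⟨hb, h⟩
      exact (D.avg_le_parent V hp' hpp').trans (by gcongr)
    have hsub : D.cover (fun p => D.Below p q ∧ (2 * N) ^ (r + 1) * l < D.avg V p) ⊆
        ⋃ p : {p // D.IsMax P p},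
          D.cover (fun p' => D.Below p' p ∧ (2 * N) ^ r * (2 * N * l) < D.avg V p') := by
      rintro x ⟨p, ⟨hpq, hp⟩, hx⟩
      have hpP : P p := by
        refine ⟨hpq, lt_of_le_of_lt ?_ hp⟩
        rw [pow_succ, mul_assoc _ (2 * N) l]
        exact le_mul_of_one_le_left' (one_le_pow₀ h1N)
      obtain ⟨m, hm, hpm⟩ := D.exists_isMax hpP
      refine Set.mem_iUnion.2 ⟨⟨m, hm⟩, p, ⟨hpm, ?_⟩, hx⟩
      convert hp using 1
      ring
    calc _ ≤ _ := lintegral_mono_set hsub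
      _ ≤ _ := lintegral_iUnion_le _ _
      _ ≤ ∑' p : {p // D.IsMax P p}, (1 - (2 * A)⁻¹) ^ r * ∫⁻ x in D.cell p, U x ∂μ :=
        ENNReal.tsum_le_tsum fun p => ih p _ hl2 hl2' (key p p.2)
      _ = (1 - (2 * A)⁻¹) ^ r * ∫⁻ x in D.cover P, U x ∂μ := by
        rw [ENNReal.tsum_mul_left, D.lintegral_cover]
      _ ≤ (1 - (2 * A)⁻¹) ^ r * ((1 - (2 * A)⁻¹) * ∫⁻ x in D.cell q, U x ∂μ) := by
        gcongr
        refine D.lintegral_le_of_half hA0 hA hU hfin hUA (D.measurableSet_cover P)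
          (fun x ⟨p, hp, hx⟩ => hp.1.2 hx) ?_
        exact D.measure_cover_le_half hl hl' hN0 hN' hq (fun p hp => hp.1) (fun p hp => hp.2.le)
      _ = _ := by ring

/-- The pairs `(k, q)` such that `q` is a maximal cell with average of `G` above `(2 * N) ^ k`,
and `q` is not of generation zero. -/
def stoppingCells (G : X → ℝ≥0∞) : Set (ℤ × (ℕ × κ)) :=
  {τ | 0 < τ.2.1 ∧ D.IsMax (fun q => (2 * N) ^ τ.1 < D.avg G q) τ.2}

lemma avg_le_of_mem_stoppingCells {G : X → ℝ≥0∞} {τ : ℤ × (ℕ × κ)} (hτ : τ ∈ D.stoppingCells G) :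
    D.avg G τ.2 ≤ N * (2 * N) ^ τ.1 := by
  obtain ⟨p, hp, hs⟩ := D.exists_parent hτ.1
  refine (D.avg_le_parent G hp hs).trans ?_
  gcongr
  exact not_lt.1 (hτ.2.2 p (by omega) hs)

/-- The part of a stopping cell that is not covered by stopping cells of higher levels. -/
def stoppingCore (G : X → ℝ≥0∞) (τ : ℤ × (ℕ × κ)) : Set X :=
  D.cell τ.2 \ D.cover fun p => (2 * N) ^ (τ.1 + 1) < D.avg G p

lemma measure_cell_le_stoppingCore [Countable κ] (hN : 1 ≤ N) (hN' : N ≠ ∞) {G : X → ℝ≥0∞}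
    {τ : ℤ × (ℕ × κ)} (hτ : τ ∈ D.stoppingCells G) :
    μ (D.cell τ.2) ≤ 2 * μ (D.stoppingCore G τ) := by
  have hN0 : N ≠ 0 := (zero_lt_one.trans_le hN).ne'
  have h2N : 2 * N ≠ 0 := mul_ne_zero two_ne_zero hN0
  have h2N' : 2 * N ≠ ∞ := ENNReal.mul_ne_top (by simp) hN'
  have hz : (2 * N) ^ (τ.1 + 1) = 2 * N * (2 * N) ^ τ.1 := by
    rw [ENNReal.zpow_add h2N h2N', zpow_one, mul_comm]
  set P : ℕ × κ → Prop := fun p => D.Below p τ.2 ∧ (2 * N) ^ (τ.1 + 1) < D.avg G p with hP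
  have h1 : 2 * μ (D.cover P) ≤ μ (D.cell τ.2) :=
    D.measure_cover_le_half (ENNReal.zpow_pos h2N h2N' τ.1).ne'
      (ENNReal.zpow_lt_top h2N h2N' τ.1).ne hN0 hN' (D.avg_le_of_mem_stoppingCells hτ)
      (fun p hp => hp.1) (fun p hp => by rw [← hz]; exact hp.2.le)
  refine (measure_le_two_mul_diff (D.measurableSet_cover P) (D.measure_cell_ne_top _)
    (fun x ⟨p, hp, hx⟩ => hp.1.2 hx) h1).trans ?_
  gcongr 2 * ?_
  refine measure_mono fun x hx => ⟨hx.1, fun ⟨p, hp, hxp⟩ => hx.2 ?_⟩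
  refine ⟨p, ⟨?_, hp⟩, hxp⟩
  have hle : τ.2.1 ≤ p.1 := by
    by_contra! hlt
    refine hτ.2.2 p hlt (D.cell_subset_of_mem hlt.le hxp hx.1) (lt_of_le_of_lt ?_ hp)
    rw [hz]
    refine le_mul_of_one_le_left' ?_
    rw [two_mul]
    exact hN.trans le_self_add
  exact ⟨hle, D.cell_subset_of_mem hle hx.1 hxp⟩

lemma measurableSet_stoppingCore [Countable κ] (G : X → ℝ≥0∞) (τ : ℤ × (ℕ × κ)) :
    MeasurableSet (D.stoppingCore G τ) :=
  (D.measurableSet_cell _).diff (D.measurableSet_cover _)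

lemma disjoint_stoppingCore (hN : 1 ≤ N) {G : X → ℝ≥0∞} {σ τ : ℤ × (ℕ × κ)}
    (hσ : σ ∈ D.stoppingCells G) (hτ : τ ∈ D.stoppingCells G) (h : σ ≠ τ) :
    Disjoint (D.stoppingCore G σ) (D.stoppingCore G τ) := by
  have h1N : 1 ≤ 2 * N := by rw [two_mul]; exact hN.trans le_self_add
  have key : ∀ {σ τ : ℤ × (ℕ × κ)}, τ ∈ D.stoppingCells G → σ.1 < τ.1 →
      ∀ x, x ∈ D.stoppingCore G σ → x ∉ D.stoppingCore G τ := by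
    intro σ τ hτ hlt x hx hx'
    refine hx.2 ⟨τ.2, lt_of_le_of_lt ?_ hτ.2.1, hx'.1⟩
    exact ENNReal.zpow_le_of_le h1N (by omega)
  refine Set.disjoint_left.2 fun x hx hx' => ?_
  rcases lt_trichotomy σ.1 τ.1 with hlt | heq | hlt
  · exact key hτ hlt x hx hx'
  · obtain ⟨k, q⟩ := σ
    obtain ⟨l, p⟩ := τ
    obtain rfl : k = l := heq
    exact h (congrArg _ (hσ.2.eq_of_mem D hτ.2 hx.1 hx'.1))
  · exact key hσ hlt x hx' hx

/-- The maximal function of `V` over the descendants of a cell. -/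
noncomputable def localMax (V : X → ℝ≥0∞) (p : ℕ × κ) (x : X) : ℝ≥0∞ :=
  ⨆ (q : ℕ × κ) (_ : D.Below q p) (_ : x ∈ D.cell q), D.avg V q

/-- The stopping cells satisfy a Carleson packing condition with respect to `V`. -/
lemma tsum_stoppingCells_le [Countable κ] (hN : 1 ≤ N) (hN' : N ≠ ∞) {G V : X → ℝ≥0∞} {B : ℝ≥0∞}
    (hB : ∀ p, ∫⁻ x in D.cell p, D.localMax V p x ∂μ ≤ B * ∫⁻ x in D.cell p, V x ∂μ)
    (p : ℕ × κ) :
    ∑' τ : {τ | τ ∈ D.stoppingCells G ∧ D.Below τ.2 p}, ∫⁻ x in D.cell τ.1.2, V x ∂μ ≤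
      2 * B * ∫⁻ x in D.cell p, V x ∂μ := by
  calc _ ≤ ∑' τ : {τ | τ ∈ D.stoppingCells G ∧ D.Below τ.2 p},
        2 * ∫⁻ x in D.stoppingCore G τ, D.localMax V p x ∂μ := by
        refine ENNReal.tsum_le_tsum fun ⟨τ, hτ, hτp⟩ => ?_
        rw [← D.avg_mul_measure]
        calc D.avg V τ.2 * μ (D.cell τ.2) ≤ D.avg V τ.2 * (2 * μ (D.stoppingCore G τ)) := by
              gcongr
              exact D.measure_cell_le_stoppingCore hN hN' hτ
          _ = 2 * ∫⁻ x in D.stoppingCore G τ, D.avg V τ.2 ∂μ := by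
              rw [setLIntegral_const]; ring
          _ ≤ _ := by
              gcongr 2 * ?_
              refine setLIntegral_mono' (D.measurableSet_stoppingCore G τ) fun x hx => ?_
              exact le_iSup₂_of_le τ.2 hτp (le_iSup_of_le hx.1 le_rfl)
    _ = 2 * ∫⁻ x in ⋃ τ : {τ | τ ∈ D.stoppingCells G ∧ D.Below τ.2 p}, D.stoppingCore G τ,
          D.localMax V p x ∂μ := by
        rw [ENNReal.tsum_mul_left, lintegral_iUnion
          (fun τ : {τ | τ ∈ D.stoppingCells G ∧ D.Below τ.2 p} =>
            D.measurableSet_stoppingCore G τ)]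
        intro σ τ h
        exact D.disjoint_stoppingCore hN σ.2.1 τ.2.1 fun h' => h (Subtype.ext h')
    _ ≤ 2 * ∫⁻ x in D.cell p, D.localMax V p x ∂μ := by
        gcongr
        exact Set.iUnion_subset fun τ x hx => τ.2.2.2 hx.1
    _ ≤ _ := by
        rw [mul_assoc]
        gcongr
        exact hB p

lemma lintegral_Ioi_indicator_ofReal_lt (y : ℝ≥0∞) :
    ∫⁻ s in Set.Ioi (0 : ℝ), {s | ENNReal.ofReal s < y}.indicator 1 s = y := by
  have hm : MeasurableSet {s : ℝ | ENNReal.ofReal s < y} :=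
    measurableSet_lt ENNReal.measurable_ofReal measurable_const
  rw [lintegral_indicator_one hm, Measure.restrict_apply hm]
  by_cases hy : y = ∞
  · subst hy
    simp
  · have : {s : ℝ | ENNReal.ofReal s < y} ∩ Set.Ioi 0 = Set.Ioo 0 y.toReal := by
      ext s
      simp only [Set.mem_inter_iff, Set.mem_ofPred_eq, Set.mem_Ioi, Set.mem_Ioo]
      constructor
      · rintro ⟨h, h0⟩
        exact ⟨h0, (ENNReal.ofReal_lt_iff_lt_toReal h0.le hy).1 h⟩
      · rintro ⟨h0, h⟩
        exact ⟨(ENNReal.ofReal_lt_iff_lt_toReal h0.le hy).2 h, h0⟩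
    rw [this, Real.volume_Ioo, sub_zero, ENNReal.ofReal_toReal hy]

/-- The maximal function over all cells. -/
noncomputable def maxFn (U : X → ℝ≥0∞) (x : X) : ℝ≥0∞ :=
  ⨆ q : ℕ × κ, (D.cell q).indicator (fun _ => D.avg U q) x

lemma measurable_maxFn [Countable κ] (U : X → ℝ≥0∞) : Measurable (D.maxFn U) :=
  Measurable.iSup fun q => measurable_const.indicator (D.measurableSet_cell q)

lemma cover_eq_lt_maxFn (U : X → ℝ≥0∞) (l : ℝ≥0∞) :
    D.cover (fun q => l < D.avg U q) = {x | l < D.maxFn U x} := by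
  ext x
  simp only [cover, maxFn, Set.mem_ofPred_eq, lt_iSup_iff]
  refine exists_congr fun q => ?_
  by_cases hx : x ∈ D.cell q <;> simp [hx]

lemma tsum_lt_avg_le [Countable κ] (hN : 1 ≤ N) (hN' : N ≠ ∞) {G U V : X → ℝ≥0∞} {B K : ℝ≥0∞}
    (hB : ∀ p, ∫⁻ x in D.cell p, D.localMax V p x ∂μ ≤ B * ∫⁻ x in D.cell p, V x ∂μ)
    {T : Set (ℤ × (ℕ × κ))} (hT : T ⊆ D.stoppingCells G)
    (hK : ∀ τ ∈ T, ∫⁻ x in D.cell τ.2, V x ∂μ ≤ K * ∫⁻ x in D.cell τ.2, G x ∂μ) (l : ℝ≥0∞) :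
    ∑' τ : {τ | τ ∈ T ∧ l < D.avg U τ.2}, ∫⁻ x in D.cell τ.1.2, V x ∂μ ≤
      2 * B * K * ∫⁻ x in {x | l < D.maxFn U x}, G x ∂μ := by
  set P : ℕ × κ → Prop := fun q => (∃ k, (k, q) ∈ T) ∧ l < D.avg U q with hP
  have hsub : {τ | τ ∈ T ∧ l < D.avg U τ.2} ⊆
      ⋃ m ∈ {m | D.IsMax P m}, {τ | τ ∈ D.stoppingCells G ∧ D.Below τ.2 m} := by
    rintro τ ⟨hτ, hl⟩
    obtain ⟨m, hm, hτm⟩ := D.exists_isMax (P := P) (q := τ.2) ⟨⟨τ.1, hτ⟩, hl⟩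
    exact Set.mem_biUnion hm ⟨hT hτ, hτm⟩
  calc _ ≤ _ := ENNReal.tsum_mono_subtype
        (fun τ : ℤ × (ℕ × κ) => ∫⁻ x in D.cell τ.2, V x ∂μ) hsub
    _ ≤ _ := ENNReal.tsum_biUnion_le_tsum
        (fun τ : ℤ × (ℕ × κ) => ∫⁻ x in D.cell τ.2, V x ∂μ) _ _
    _ ≤ ∑' m : {m | D.IsMax P m}, 2 * B * (K * ∫⁻ x in D.cell m, G x ∂μ) := by
        refine ENNReal.tsum_le_tsum fun ⟨m, hm⟩ => ?_
        refine (D.tsum_stoppingCells_le hN hN' hB m).trans ?_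
        obtain ⟨k, hk⟩ := hm.1.1
        gcongr
        exact hK _ hk
    _ = 2 * B * K * ∫⁻ x in D.cover P, G x ∂μ := by
        rw [ENNReal.tsum_mul_left, ENNReal.tsum_mul_left, D.lintegral_cover, ← mul_assoc]
        rfl
    _ ≤ _ := by
        rw [← D.cover_eq_lt_maxFn]
        gcongr
        rintro x ⟨q, hq, hx⟩
        exact ⟨q, hq.2, hx⟩

/-- Carleson embedding for the stopping cells. -/
lemma tsum_avg_mul_le [Countable κ] [SFinite μ] (hN : 1 ≤ N) (hN' : N ≠ ∞) {G U V : X → ℝ≥0∞}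
    {A B K : ℝ≥0∞} (hG : Measurable G) (hU : Measurable U)
    (hUA : ∀ᵐ x ∂μ, ∀ q, x ∈ D.cell q → D.avg U q ≤ A * U x)
    (hB : ∀ p, ∫⁻ x in D.cell p, D.localMax V p x ∂μ ≤ B * ∫⁻ x in D.cell p, V x ∂μ)
    {T : Set (ℤ × (ℕ × κ))} (hT : T ⊆ D.stoppingCells G)
    (hK : ∀ τ ∈ T, ∫⁻ x in D.cell τ.2, V x ∂μ ≤ K * ∫⁻ x in D.cell τ.2, G x ∂μ) :
    ∑' τ : T, D.avg U τ.1.2 * ∫⁻ x in D.cell τ.1.2, V x ∂μ ≤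
      2 * B * K * (A * ∫⁻ x, G x * U x ∂μ) := by
  have hm : ∀ y : ℝ≥0∞, MeasurableSet {s : ℝ | ENNReal.ofReal s < y} := fun y =>
    measurableSet_lt ENNReal.measurable_ofReal measurable_const
  have hprod : MeasurableSet {z : ℝ × X | ENNReal.ofReal z.1 < D.maxFn U z.2} :=
    measurableSet_lt (ENNReal.measurable_ofReal.comp measurable_fst)
      ((D.measurable_maxFn U).comp measurable_snd)
  calc ∑' τ : T, D.avg U τ.1.2 * ∫⁻ x in D.cell τ.1.2, V x ∂μ
      = ∑' τ : T, ∫⁻ s in Set.Ioi (0 : ℝ), {s | ENNReal.ofReal s < D.avg U τ.1.2}.indicator 1 s *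
          ∫⁻ x in D.cell τ.1.2, V x ∂μ := by
        refine tsum_congr fun τ => ?_
        rw [lintegral_mul_const _ (measurable_one.indicator (hm _)),
          lintegral_Ioi_indicator_ofReal_lt]
    _ = ∫⁻ s in Set.Ioi (0 : ℝ), ∑' τ : T,
          {s | ENNReal.ofReal s < D.avg U τ.1.2}.indicator 1 s *
            ∫⁻ x in D.cell τ.1.2, V x ∂μ := by
        rw [lintegral_tsum]
        exact fun τ => ((measurable_one.indicator (hm _)).mul_const _).aemeasurable
    _ ≤ ∫⁻ s in Set.Ioi (0 : ℝ),
          2 * B * K * ∫⁻ x in {x | ENNReal.ofReal s < D.maxFn U x}, G x ∂μ := by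
        refine lintegral_mono fun s => ?_
        refine le_trans (le_of_eq ?_)
          (D.tsum_lt_avg_le (U := U) hN hN' hB hT hK (ENNReal.ofReal s))
        rw [tsum_subtype T (fun τ => {s | ENNReal.ofReal s < D.avg U τ.2}.indicator 1 s *
            ∫⁻ x in D.cell τ.2, V x ∂μ), tsum_subtype {τ | τ ∈ T ∧ ENNReal.ofReal s < D.avg U τ.2}
            (fun τ => ∫⁻ x in D.cell τ.2, V x ∂μ)]
        refine tsum_congr fun τ => ?_
        by_cases h1 : τ ∈ T <;> by_cases h2 : ENNReal.ofReal s < D.avg U τ.2 <;>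
          simp [h1, h2]
    _ = ∫⁻ s in Set.Ioi (0 : ℝ), ∫⁻ x,
          2 * B * K * ({z : ℝ × X | ENNReal.ofReal z.1 < D.maxFn U z.2}.indicator 1 (s, x) * G x)
            ∂μ := by
        refine lintegral_congr fun s => ?_
        have hms : MeasurableSet {x | ENNReal.ofReal s < D.maxFn U x} :=
          measurableSet_lt measurable_const (D.measurable_maxFn U)
        have h1 : Measurable fun x : X =>
            {z : ℝ × X | ENNReal.ofReal z.1 < D.maxFn U z.2}.indicator (1 : ℝ × X → ℝ≥0∞) (s, x) :=
          (measurable_one.indicator hprod).comp measurable_prodMk_left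
        have h2 : Measurable fun x : X =>
            {z : ℝ × X | ENNReal.ofReal z.1 < D.maxFn U z.2}.indicator (1 : ℝ × X → ℝ≥0∞) (s, x) *
              G x := h1.mul hG
        rw [lintegral_const_mul _ h2, ← lintegral_indicator hms]
        congr 1
        refine lintegral_congr fun x => ?_
        by_cases h : ENNReal.ofReal s < D.maxFn U x <;> simp [h]
    _ = ∫⁻ x, (∫⁻ s in Set.Ioi (0 : ℝ), 2 * B * K *
          ({z : ℝ × X | ENNReal.ofReal z.1 < D.maxFn U z.2}.indicator 1 (s, x) * G x)) ∂μ := by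
        refine lintegral_lintegral_swap (Measurable.aemeasurable ?_)
        exact ((measurable_one.indicator hprod).mul (hG.comp measurable_snd)).const_mul _
    _ = ∫⁻ x, 2 * B * K * (D.maxFn U x * G x) ∂μ := by
        refine lintegral_congr fun x => ?_
        have h1 : Measurable fun s : ℝ =>
            {z : ℝ × X | ENNReal.ofReal z.1 < D.maxFn U z.2}.indicator (1 : ℝ × X → ℝ≥0∞) (s, x) :=
          (measurable_one.indicator hprod).comp measurable_prodMk_right
        rw [lintegral_const_mul _ (h1.mul_const _), lintegral_mul_const _ h1]
        congr 2
        exact lintegral_Ioi_indicator_ofReal_lt (D.maxFn U x)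
    _ ≤ ∫⁻ x, 2 * B * K * (A * (G x * U x)) ∂μ := by
        refine lintegral_mono_ae ?_
        filter_upwards [hUA] with x hx
        have : D.maxFn U x ≤ A * U x := by
          refine iSup_le fun q => ?_
          by_cases hq : x ∈ D.cell q
          · simpa [hq] using hx q hq
          · simp [hq]
        calc 2 * B * K * (D.maxFn U x * G x) ≤ 2 * B * K * (A * U x * G x) := by gcongr
          _ = _ := by ring
    _ = _ := by
        rw [lintegral_const_mul _ (by fun_prop), lintegral_const_mul _ (by fun_prop)]

/-- The stopping cells of level `k` on which the average of `V` is comparable to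
`(2 * N) ^ (k + m)`. -/
def stoppingClass (G V : X → ℝ≥0∞) (m : ℤ) : Set (ℤ × (ℕ × κ)) :=
  {τ | τ ∈ D.stoppingCells G ∧
    D.avg V τ.2 ∈ Set.Ioc ((2 * N) ^ (τ.1 + m)) ((2 * N) ^ (τ.1 + m + 1))}

/-- The part of a stopping cell of level `k` on which `V` is comparable to `(2 * N) ^ k`. -/
def band (V : X → ℝ≥0∞) (τ : ℤ × (ℕ × κ)) : Set X :=
  D.cell τ.2 ∩ {x | V x ∈ Set.Ioc ((2 * N) ^ τ.1) ((2 * N) ^ (τ.1 + 1))}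

lemma measurableSet_band {V : X → ℝ≥0∞} (hV : Measurable V) (τ : ℤ × (ℕ × κ)) :
    MeasurableSet (D.band V τ) :=
  (D.measurableSet_cell _).inter (hV measurableSet_Ioc)

lemma lintegral_band_le {U V : X → ℝ≥0∞} (hU : Measurable U) (hV : Measurable V)
    (τ : ℤ × (ℕ × κ)) :
    ∫⁻ x in D.band V τ, U x * V x ∂μ ≤ (2 * N) ^ (τ.1 + 1) * ∫⁻ x in D.band V τ, U x ∂μ := by
  rw [← lintegral_const_mul _ hU]
  refine setLIntegral_mono' (D.measurableSet_band hV τ) fun x hx => ?_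
  rw [mul_comm]
  gcongr
  exact hx.2.2

lemma tsum_stoppingClass_le [Countable κ] [SFinite μ] (hN : 1 ≤ N) (hN' : N ≠ ∞)
    {G U V : X → ℝ≥0∞} {A B : ℝ≥0∞} (hG : Measurable G) (hU : Measurable U)
    (hUA : ∀ᵐ x ∂μ, ∀ q, x ∈ D.cell q → D.avg U q ≤ A * U x)
    (hB : ∀ p, ∫⁻ x in D.cell p, D.localMax V p x ∂μ ≤ B * ∫⁻ x in D.cell p, V x ∂μ)
    (m : ℤ) {b : ℝ≥0∞} (hb : ∀ τ ∈ D.stoppingClass G V m, ∫⁻ x in D.band V τ, U x * V x ∂μ ≤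
      b * ((2 * N) ^ (τ.1 + 1) * ∫⁻ x in D.cell τ.2, U x ∂μ)) :
    ∑' τ : D.stoppingClass G V m, ∫⁻ x in D.band V τ, U x * V x ∂μ ≤
      b * (2 * (2 * N) ^ 2 * (A * B * ∫⁻ x, G x * U x ∂μ)) := by
  have hN0 : N ≠ 0 := (zero_lt_one.trans_le hN).ne'
  have h2N : 2 * N ≠ 0 := mul_ne_zero two_ne_zero hN0
  have h2N' : 2 * N ≠ ∞ := ENNReal.mul_ne_top (by simp) hN'
  have hz : ∀ i j : ℤ, (2 * N) ^ (i + j) = (2 * N) ^ i * (2 * N) ^ j := fun i j =>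
    ENNReal.zpow_add h2N h2N' i j
  have hK : ∀ τ ∈ D.stoppingClass G V m, ∫⁻ x in D.cell τ.2, V x ∂μ ≤
      (2 * N) ^ (m + 1) * ∫⁻ x in D.cell τ.2, G x ∂μ := by
    intro τ hτ
    rw [← D.avg_mul_measure, ← D.avg_mul_measure, ← mul_assoc]
    gcongr
    calc D.avg V τ.2 ≤ (2 * N) ^ (τ.1 + m + 1) := hτ.2.2
      _ = (2 * N) ^ (m + 1) * (2 * N) ^ τ.1 := by rw [← hz]; congr 1; ring
      _ ≤ _ := by gcongr; exact hτ.1.2.1.le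
  calc ∑' τ : D.stoppingClass G V m, ∫⁻ x in D.band V τ, U x * V x ∂μ
      ≤ ∑' τ : D.stoppingClass G V m, b * ((2 * N) ^ (1 - m) *
          (D.avg U τ.1.2 * ∫⁻ x in D.cell τ.1.2, V x ∂μ)) := by
        refine ENNReal.tsum_le_tsum fun ⟨τ, hτ⟩ => (hb τ hτ).trans ?_
        gcongr b * ?_
        rw [← D.avg_mul_lintegral V U, ← mul_assoc]
        gcongr
        calc (2 * N) ^ (τ.1 + 1) = (2 * N) ^ (1 - m) * (2 * N) ^ (τ.1 + m) := by
              rw [← hz]; congr 1; ring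
          _ ≤ _ := by gcongr; exact hτ.2.1.le
    _ = b * ((2 * N) ^ (1 - m) * ∑' τ : D.stoppingClass G V m,
          D.avg U τ.1.2 * ∫⁻ x in D.cell τ.1.2, V x ∂μ) := by
        rw [ENNReal.tsum_mul_left, ENNReal.tsum_mul_left]
    _ ≤ b * ((2 * N) ^ (1 - m) *
          (2 * B * (2 * N) ^ (m + 1) * (A * ∫⁻ x, G x * U x ∂μ))) := by
        gcongr
        exact D.tsum_avg_mul_le hN hN' hG hU hUA hB (fun τ hτ => hτ.1) hK
    _ = _ := by
        have : (2 * N) ^ 2 = (2 * N) ^ (1 - m) * (2 * N) ^ (m + 1) := by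
          rw [← hz, show 1 - m + (m + 1) = ((2 : ℕ) : ℤ) by push_cast; ring, zpow_natCast]
        rw [this]
        ring

lemma lintegral_band_le_pow [Countable κ] {G U V : X → ℝ≥0∞} {A : ℝ≥0∞} (hN : 1 ≤ N)
    (hN' : N ≠ ∞) (hA0 : A ≠ 0) (hA : A ≠ ∞) (hU : Measurable U) (hV : Measurable V)
    (hfin : ∀ q, ∫⁻ x in D.cell q, U x ∂μ ≠ ∞)
    (hUA : ∀ᵐ x ∂μ, ∀ q, x ∈ D.cell q → D.avg U q ≤ A * U x)
    (hdiff : ∀ᵐ x ∂μ, ∀ (j : ℕ) (l : ℝ≥0∞), l < V x →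
      ∃ q, j ≤ q.1 ∧ x ∈ D.cell q ∧ l < D.avg V q)
    (r : ℕ) {τ : ℤ × (ℕ × κ)} (hτ : τ ∈ D.stoppingClass G V (-(r + 1))) :
    ∫⁻ x in D.band V τ, U x * V x ∂μ ≤
      (1 - (2 * A)⁻¹) ^ r * ((2 * N) ^ (τ.1 + 1) * ∫⁻ x in D.cell τ.2, U x ∂μ) := by
  have hN0 : N ≠ 0 := (zero_lt_one.trans_le hN).ne'
  have h2N : 2 * N ≠ 0 := mul_ne_zero two_ne_zero hN0
  have h2N' : 2 * N ≠ ∞ := ENNReal.mul_ne_top (by simp) hN'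
  have hl : (2 * N) ^ r * (2 * N) ^ (τ.1 - r) = (2 * N) ^ τ.1 := by
    rw [← zpow_natCast, ← ENNReal.zpow_add h2N h2N']
    congr 1; ring
  have havg : D.avg V τ.2 ≤ N * (2 * N) ^ (τ.1 - r) := by
    calc D.avg V τ.2 ≤ (2 * N) ^ (τ.1 + -(r + 1) + 1) := hτ.2.2
      _ = (2 * N) ^ (τ.1 - r) := by congr 1; ring
      _ ≤ _ := le_mul_of_one_le_left' hN
  have hsub : D.band V τ ≤ᵐ[μ]
      D.cover (fun p => D.Below p τ.2 ∧ (2 * N) ^ r * (2 * N) ^ (τ.1 - r) < D.avg V p) := by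
    filter_upwards [hdiff] with x hx hxb
    obtain ⟨q, hq, hxq, hlq⟩ := hx τ.2.1 _ hxb.2.1
    exact ⟨q, ⟨⟨hq, D.cell_subset_of_mem hq hxb.1 hxq⟩, hl ▸ hlq⟩, hxq⟩
  calc _ ≤ _ := D.lintegral_band_le hU hV τ
    _ ≤ _ := mul_le_mul_right (lintegral_mono_set' hsub) _
    _ ≤ _ := mul_le_mul_right (D.lintegral_cover_le_pow hN hN' hA0 hA hU hfin hUA r τ.2 _
        (ENNReal.zpow_pos h2N h2N' _).ne' (ENNReal.zpow_lt_top h2N h2N' _).ne havg) _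
    _ = _ := by ring

lemma lintegral_band_eq_zero {G U V : X → ℝ≥0∞} {C : ℝ≥0∞} (hN : 1 ≤ N) (hN' : N ≠ ∞)
    (hC : C ≠ ∞) (hVC : ∀ᵐ x ∂μ, ∀ q, x ∈ D.cell q → D.avg V q ≤ C * V x) (m : ℕ)
    (hm : 1 + 2 * max (Real.log C.toReal) 0 ≤ m) {τ : ℤ × (ℕ × κ)}
    (hτ : τ ∈ D.stoppingClass G V m) :
    ∫⁻ x in D.band V τ, U x * V x ∂μ = 0 := by
  have hN0 : N ≠ 0 := (zero_lt_one.trans_le hN).ne'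
  have h2N : 2 * N ≠ 0 := mul_ne_zero two_ne_zero hN0
  have h2N' : 2 * N ≠ ∞ := ENNReal.mul_ne_top (by simp) hN'
  refine setLIntegral_measure_zero _ _ ?_
  rw [measure_eq_zero_iff_ae_notMem]
  filter_upwards [hVC] with x hx hxb
  have h1 : (2 * N) ^ (τ.1 + m) < C * (2 * N) ^ (τ.1 + 1) :=
    calc (2 * N) ^ (τ.1 + m) < D.avg V τ.2 := hτ.2.1
      _ ≤ C * V x := hx _ hxb.1
      _ ≤ _ := by gcongr; exact hxb.2.2
  obtain ⟨i, rfl⟩ : ∃ i : ℕ, m = i + 1 := by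
    refine ⟨m - 1, ?_⟩
    have : (1 : ℝ) ≤ m := le_trans (by linarith [le_max_right (Real.log C.toReal) 0]) hm
    have : 1 ≤ m := by exact_mod_cast this
    omega
  have h2 : (2 * N) ^ i < C := by
    have : (2 * N) ^ (τ.1 + (i + 1 : ℕ)) = (2 * N) ^ i * (2 * N) ^ (τ.1 + 1) := by
      rw [← zpow_natCast, ← ENNReal.zpow_add h2N h2N']
      congr 1; push_cast; ring
    rw [this] at h1
    exact lt_of_mul_lt_mul_right' h1
  have h3 : (2 : ℝ≥0∞) ^ i < C := by
    refine lt_of_le_of_lt ?_ h2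
    gcongr
    exact le_mul_of_one_le_right' hN
  have h4 : (2 : ℝ) ^ i < C.toReal := by
    have := (ENNReal.toReal_lt_toReal (by simp) hC).2 h3
    simpa using this
  have h5 : i * Real.log 2 < Real.log C.toReal := by
    rw [← Real.log_pow]
    exact Real.log_lt_log (by positivity) h4
  have h6 := Real.log_two_gt_d9
  have h7 := le_max_left (Real.log C.toReal) 0
  push_cast at hm
  have h8 : (0 : ℝ) ≤ i := by positivity
  nlinarith

lemma tsum_ite_le (y : ℝ) (hy : 0 ≤ y) (b : ℝ≥0∞) :
    ∑' m : ℕ, (if 1 + y ≤ m then 0 else b) ≤ ENNReal.ofReal (2 + y) * b := by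
  rw [tsum_eq_sum (s := Finset.range ⌈1 + y⌉₊)]
  · calc ∑ m ∈ Finset.range ⌈1 + y⌉₊, (if 1 + y ≤ m then 0 else b)
        ≤ ∑ m ∈ Finset.range ⌈1 + y⌉₊, b := by
          refine Finset.sum_le_sum fun m _ => ?_
          split_ifs <;> simp
      _ = ⌈1 + y⌉₊ * b := by simp
      _ ≤ _ := by
          gcongr
          rw [← ENNReal.ofReal_natCast]
          refine ENNReal.ofReal_le_ofReal ?_
          linarith [Nat.ceil_lt_add_one (show 0 ≤ 1 + y by linarith)]
  · intro m hm
    rw [Finset.mem_range, not_lt] at hm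
    exact if_pos (Nat.ceil_le.1 hm)

lemma lintegral_root_le [Countable κ] {G U V : X → ℝ≥0∞} {A : ℝ≥0∞}
    (hG : Measurable G) (hU : Measurable U) (hV : Measurable V)
    (hUA : ∀ᵐ x ∂μ, ∀ q, x ∈ D.cell q → D.avg U q ≤ A * U x) (b : ℝ≥0∞) :
    ∫⁻ x in ⋃ k : κ, D.cell (0, k) ∩ {x | V x ≤ b * D.avg G (0, k)}, U x * V x ∂μ ≤
      b * (A * ∫⁻ x, G x * U x ∂μ) := by
  calc _ ≤ _ := lintegral_iUnion_le _ _
    _ ≤ ∑' k : κ, b * (A * ∫⁻ x in D.cell (0, k), G x * U x ∂μ) := by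
        refine ENNReal.tsum_le_tsum fun k => ?_
        calc ∫⁻ x in D.cell (0, k) ∩ {x | V x ≤ b * D.avg G (0, k)}, U x * V x ∂μ
            ≤ ∫⁻ x in D.cell (0, k) ∩ {x | V x ≤ b * D.avg G (0, k)},
                b * D.avg G (0, k) * U x ∂μ := by
              refine setLIntegral_mono' ((D.measurableSet_cell _).inter
                (measurableSet_le hV measurable_const)) fun x hx => ?_
              rw [mul_comm]
              gcongr
              exact hx.2
          _ ≤ ∫⁻ x in D.cell (0, k), b * D.avg G (0, k) * U x ∂μ :=
              lintegral_mono_set Set.inter_subset_left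
          _ = b * (D.avg U (0, k) * ∫⁻ x in D.cell (0, k), G x ∂μ) := by
              rw [lintegral_const_mul _ hU, mul_assoc, D.avg_mul_lintegral]
          _ = b * ∫⁻ x in D.cell (0, k), D.avg U (0, k) * G x ∂μ := by
              rw [lintegral_const_mul _ hG]
          _ ≤ b * ∫⁻ x in D.cell (0, k), A * (G x * U x) ∂μ := by
              gcongr b * ?_
              refine setLIntegral_mono_ae (by fun_prop) ?_
              filter_upwards [hUA] with x hx hxq
              calc D.avg U (0, k) * G x ≤ A * U x * G x := by gcongr; exact hx _ hxq
                _ = _ := by ring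
          _ = _ := by rw [lintegral_const_mul _ (by fun_prop)]
    _ = b * (A * ∫⁻ x in ⋃ k : κ, D.cell (0, k), G x * U x ∂μ) := by
        rw [ENNReal.tsum_mul_left, ENNReal.tsum_mul_left,
          lintegral_iUnion (fun k => D.measurableSet_cell _)]
        intro k l hkl
        refine Set.disjoint_left.2 fun x hk hl => hkl ?_
        exact Eq.trans (Eq.symm hk) hl
    _ ≤ _ := by
        gcongr
        exact Measure.restrict_le_self

/-- The mixed weak-type estimate for the maximal operator of a cell system. -/
theorem lintegral_lt_maxFn_le [Countable κ] [SFinite μ] (hN : 1 ≤ N) (hN' : N ≠ ∞)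
    {G U V : X → ℝ≥0∞} {A B C : ℝ≥0∞} (hG : Measurable G) (hU : Measurable U) (hV : Measurable V)
    (hA : 1 ≤ A) (hA' : A ≠ ∞) (hB1 : 1 ≤ B) (hC : C ≠ ∞)
    (hUfin : ∀ q, ∫⁻ x in D.cell q, U x ∂μ ≠ ∞) (hVfin : ∀ q, ∫⁻ x in D.cell q, V x ∂μ ≠ ∞)
    (hV0 : ∀ᵐ x ∂μ, V x ≠ 0) (hVtop : ∀ᵐ x ∂μ, V x ≠ ∞)
    (hUA : ∀ᵐ x ∂μ, ∀ q, x ∈ D.cell q → D.avg U q ≤ A * U x)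
    (hVC : ∀ᵐ x ∂μ, ∀ q, x ∈ D.cell q → D.avg V q ≤ C * V x)
    (hB : ∀ p, ∫⁻ x in D.cell p, D.localMax V p x ∂μ ≤ B * ∫⁻ x in D.cell p, V x ∂μ)
    (hdiff : ∀ᵐ x ∂μ, ∀ (j : ℕ) (l : ℝ≥0∞), l < V x →
      ∃ q, j ≤ q.1 ∧ x ∈ D.cell q ∧ l < D.avg V q) :
    ∫⁻ x in {x | ∃ q, x ∈ D.cell q ∧ V x < D.avg G q}, U x * V x ∂μ ≤
      9 * (2 * N) ^ 2 * (A * B * (A + 1 + ENNReal.ofReal (Real.log C.toReal))) *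
        ∫⁻ x, G x * U x ∂μ := by
  have hN0 : N ≠ 0 := (zero_lt_one.trans_le hN).ne'
  have h2N : 2 * N ≠ 0 := mul_ne_zero two_ne_zero hN0
  have h2N' : 2 * N ≠ ∞ := ENNReal.mul_ne_top (by simp) hN'
  have h1N : 1 < 2 * N := by
    rw [two_mul]; exact hN.trans_lt (ENNReal.lt_add_right hN' hN0)
  have hA0 : A ≠ 0 := (zero_lt_one.trans_le hA).ne'
  set I := ∫⁻ x, G x * U x ∂μ with hI
  set y : ℝ := 2 * max (Real.log C.toReal) 0 with hy
  set Y : ℝ≥0∞ := 2 * (2 * N) ^ 2 * (A * B * I) with hY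
  have hsub : ({x | ∃ q, x ∈ D.cell q ∧ V x < D.avg G q} : Set X) ≤ᵐ[μ]
      ((⋃ k : κ, D.cell (0, k) ∩ {x | V x ≤ 2 * N * D.avg G (0, k)}) ∪
        ⋃ τ : D.stoppingCells G, D.band V τ : Set X) := by
    filter_upwards [hV0, hVtop] with x hx0 hxt ⟨q, hxq, hq⟩
    obtain ⟨k, hk⟩ := ENNReal.exists_mem_Ioc_zpow hx0 hxt h1N h2N'
    obtain ⟨p, hp, hqp⟩ := D.exists_isMax
      (P := fun q => (2 * N) ^ k < D.avg G q) (hk.1.trans hq)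
    obtain ⟨j, l⟩ := p
    rcases Nat.eq_zero_or_pos j with rfl | hj
    · refine Or.inl (Set.mem_iUnion.2 ⟨l, hqp.2 hxq, hk.2.trans ?_⟩)
      rw [ENNReal.zpow_add h2N h2N', zpow_one, mul_comm]
      gcongr
      exact hp.1.le
    · exact Or.inr (Set.mem_iUnion.2 ⟨⟨(k, (j, l)), hj, hp⟩, hqp.2 hxq, hk⟩)
  have hclass : D.stoppingCells G ⊆ ⋃ m : ℤ, D.stoppingClass G V m := by
    intro τ hτ
    have h0 : D.avg V τ.2 ≠ 0 := by
      intro h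
      have h1 : ∫⁻ x in D.cell τ.2, V x ∂μ = 0 := by rw [← D.avg_mul_measure, h, zero_mul]
      rw [setLIntegral_eq_zero_iff (D.measurableSet_cell _) hV] at h1
      refine D.measure_cell_ne_zero τ.2 ?_
      rw [measure_eq_zero_iff_ae_notMem]
      filter_upwards [h1, hV0] with x hx hx0 hxq using hx0 (hx hxq)
    have ht : D.avg V τ.2 ≠ ∞ := ENNReal.div_ne_top (hVfin _) (D.measure_cell_ne_zero _)
    obtain ⟨k, hk⟩ := ENNReal.exists_mem_Ioc_zpow h0 ht h1N h2N'
    refine Set.mem_iUnion.2 ⟨k - τ.1, hτ, ?_⟩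
    rwa [add_sub_cancel]
  have hnonneg : ∀ m : ℕ, ∑' τ : D.stoppingClass G V m, ∫⁻ x in D.band V τ, U x * V x ∂μ ≤
      if 1 + y ≤ m then 0 else Y := by
    intro m
    split_ifs with hm
    · rw [← zero_mul Y]
      refine D.tsum_stoppingClass_le hN hN' hG hU hUA hB m fun τ hτ => ?_
      rw [D.lintegral_band_eq_zero hN hN' hC hVC m hm hτ]
      exact zero_le
    · rw [← one_mul Y]
      refine D.tsum_stoppingClass_le hN hN' hG hU hUA hB m fun τ hτ => ?_
      rw [one_mul]
      refine (D.lintegral_band_le hU hV τ).trans ?_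
      gcongr
      exact Set.inter_subset_left
  have hneg : ∀ r : ℕ, ∑' τ : D.stoppingClass G V (-(r + 1)),
      ∫⁻ x in D.band V τ, U x * V x ∂μ ≤ (1 - (2 * A)⁻¹) ^ r * Y := fun r =>
    D.tsum_stoppingClass_le hN hN' hG hU hUA hB _ fun τ hτ =>
      D.lintegral_band_le_pow hN hN' hA0 hA' hU hV hUfin hUA hdiff r hτ
  have hgeom : ∑' r : ℕ, (1 - (2 * A)⁻¹) ^ r = 2 * A := by
    rw [ENNReal.tsum_geometric, ENNReal.sub_sub_cancel (by simp), inv_inv]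
    rw [ENNReal.inv_le_one, two_mul]
    exact hA.trans le_self_add
  have hsum : ∑' τ : D.stoppingCells G, ∫⁻ x in D.band V τ, U x * V x ∂μ ≤
      ENNReal.ofReal (2 + y) * Y + 2 * A * Y :=
    calc _ ≤ _ := ENNReal.tsum_mono_subtype (fun τ => ∫⁻ x in D.band V τ, U x * V x ∂μ) hclass
      _ ≤ ∑' m : ℤ, ∑' τ : D.stoppingClass G V m, ∫⁻ x in D.band V τ, U x * V x ∂μ :=
        ENNReal.tsum_iUnion_le_tsum (fun τ => ∫⁻ x in D.band V τ, U x * V x ∂μ) _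
      _ = _ := tsum_of_nat_of_neg_add_one ENNReal.summable ENNReal.summable
      _ ≤ ∑' m : ℕ, (if 1 + y ≤ m then 0 else Y) + ∑' r : ℕ, (1 - (2 * A)⁻¹) ^ r * Y :=
        add_le_add (ENNReal.tsum_le_tsum hnonneg) (ENNReal.tsum_le_tsum hneg)
      _ ≤ _ := by
        rw [ENNReal.tsum_mul_right, hgeom]
        gcongr
        exact tsum_ite_le y (by positivity) Y
  have hlog : ENNReal.ofReal (2 + y) = 2 + 2 * ENNReal.ofReal (Real.log C.toReal) := by
    rw [hy, ENNReal.ofReal_add (by norm_num) (by positivity), ENNReal.ofReal_mul (by norm_num)]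
    simp [ENNReal.ofReal_max]
  calc _ ≤ _ := lintegral_mono_set' hsub
    _ ≤ _ := lintegral_union_le _ _ _
    _ ≤ 2 * N * (A * I) + (ENNReal.ofReal (2 + y) * Y + 2 * A * Y) :=
        add_le_add (D.lintegral_root_le hG hU hV hUA _) ((lintegral_iUnion_le _ _).trans hsum)
    _ ≤ (2 * N) ^ 2 * (A * B * (A * I)) + (ENNReal.ofReal (2 + y) * Y + 2 * A * Y) := by
        gcongr
        · rw [sq]; exact le_mul_of_one_le_left' h1N.le
        · exact le_mul_of_one_le_right' hB1
        · exact le_mul_of_one_le_left' hA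
    _ = (2 * N) ^ 2 * (A * B) * (5 * A + 4 + 4 * ENNReal.ofReal (Real.log C.toReal)) * I := by
        rw [hlog, hY]; ring
    _ ≤ (2 * N) ^ 2 * (A * B) * (9 * A + 9 + 9 * ENNReal.ofReal (Real.log C.toReal)) * I := by
        gcongr <;> norm_num
    _ = _ := by ring

end CellSystem

/-- The label of the half-open cube of side `L / 2 ^ j` that contains a given point, in the grid
through `t`. -/
noncomputable def gridIdx {n : ℕ} (t : Fin n → ℝ) (L : ℝ) (j : ℕ) (x : Fin n → ℝ) : Fin n → ℤ :=
  fun i => ⌊(x i - t i) / (L / 2 ^ j)⌋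

lemma setOf_gridIdx_eq {n : ℕ} (t : Fin n → ℝ) {L : ℝ} (hL : 0 < L) (j : ℕ) (k : Fin n → ℤ) :
    {x | gridIdx t L j x = k} = Set.univ.pi fun i =>
      Set.Ico (t i + k i * (L / 2 ^ j)) (t i + k i * (L / 2 ^ j) + L / 2 ^ j) := by
  have hs : 0 < L / 2 ^ j := by positivity
  ext x
  simp only [Set.mem_ofPred_eq, funext_iff, gridIdx, Int.floor_eq_iff, Set.mem_univ_pi, Set.mem_Ico,
    le_div_iff₀ hs, div_lt_iff₀ hs]
  refine forall_congr' fun i => ?_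
  constructor <;> rintro ⟨h1, h2⟩ <;> constructor <;> linarith

lemma volume_setOf_gridIdx_eq {n : ℕ} (t : Fin n → ℝ) {L : ℝ} (hL : 0 < L) (j : ℕ)
    (k : Fin n → ℤ) :
    volume {x | gridIdx t L j x = k} = ENNReal.ofReal (L / 2 ^ j) ^ n := by
  rw [setOf_gridIdx_eq t hL, Real.volume_pi_Ico]
  simp

/-- The dyadic grid through `t` whose cubes have sides `L`, `L / 2`, `L / 4` and so on. -/
noncomputable def dyadicGrid {n : ℕ} (t : Fin n → ℝ) {L : ℝ} (hL : 0 < L) :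
    CellSystem (volume : Measure (Fin n → ℝ)) (2 ^ n) (Fin n → ℤ) where
  idx := gridIdx t L
  measurableSet_fiber j k := by
    rw [setOf_gridIdx_eq t hL]
    exact MeasurableSet.univ_pi fun i => measurableSet_Ico
  nested j x y h := by
    have key : ∀ z : Fin n → ℝ, gridIdx t L j z = fun i => gridIdx t L (j + 1) z i / 2 := by
      intro z
      funext i
      have := Int.floor_div_natCast ((z i - t i) / (L / 2 ^ (j + 1))) 2
      rw [gridIdx, gridIdx, ← Nat.cast_ofNat (R := ℤ) (n := 2), ← this]
      congr 1
      push_cast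
      field_simp
      ring
    rw [key x, key y, h]
  measure_ne_zero j k := by
    rw [volume_setOf_gridIdx_eq t hL]
    exact pow_ne_zero _ (ENNReal.ofReal_pos.2 (by positivity)).ne'
  measure_ne_top j k := by
    rw [volume_setOf_gridIdx_eq t hL]
    exact ENNReal.pow_ne_top ENNReal.ofReal_ne_top
  doubling j k k' _ := by
    rw [volume_setOf_gridIdx_eq t hL, volume_setOf_gridIdx_eq t hL, ← mul_pow,
      ← ENNReal.ofReal_ofNat 2, ← ENNReal.ofReal_mul (by norm_num)]
    gcongr
    apply le_of_eq
    field_simp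
    exact pow_succ _ _

/-- The closed cube with corner `a` and side `h`. -/
def closedCube {n : ℕ} (a : Fin n → ℝ) (h : ℝ) : Set (Fin n → ℝ) :=
  {x | ∀ i, a i ≤ x i ∧ x i ≤ a i + h}

lemma isCube_closedCube {n : ℕ} (a : Fin n → ℝ) {h : ℝ} (hh : 0 < h) : IsCube (closedCube a h) :=
  ⟨a, h, hh, rfl⟩

lemma closedCube_eq_Icc {n : ℕ} (a : Fin n → ℝ) (h : ℝ) :
    closedCube a h = Set.Icc a (a + fun _ => h) := by
  ext x
  simp [closedCube, Pi.le_def, forall_and]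

lemma volume_closedCube {n : ℕ} (a : Fin n → ℝ) (h : ℝ) :
    volume (closedCube a h) = ENNReal.ofReal h ^ n := by
  rw [closedCube_eq_Icc, Real.volume_Icc_pi]
  simp

lemma closedCube_eq_closedBall {n : ℕ} (a : Fin n → ℝ) {h : ℝ} (hh : 0 ≤ h) :
    closedCube a h = Metric.closedBall (fun i => a i + h / 2) (h / 2) := by
  ext x
  rw [closedBall_pi _ (by positivity)]
  simp only [closedCube, Set.mem_ofPred_eq, Set.mem_univ_pi, Real.closedBall_eq_Icc, Set.mem_Icc]
  refine forall_congr' fun i => ?_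
  constructor <;> rintro ⟨h1, h2⟩ <;> constructor <;> linarith

/-- The closure of a cell of a dyadic grid. -/
noncomputable def gridCube {n : ℕ} (t : Fin n → ℝ) (L : ℝ) (q : ℕ × (Fin n → ℤ)) :
    Set (Fin n → ℝ) :=
  closedCube (fun i => t i + q.2 i * (L / 2 ^ q.1)) (L / 2 ^ q.1)

lemma isCube_gridCube {n : ℕ} (t : Fin n → ℝ) {L : ℝ} (hL : 0 < L) (q : ℕ × (Fin n → ℤ)) :
    IsCube (gridCube t L q) :=
  isCube_closedCube _ (by positivity)

lemma ENNReal.one_le_of_le_mul {a b : ℝ≥0∞} (h0 : b ≠ 0) (ht : b ≠ ∞) (h : b ≤ a * b) :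
    1 ≤ a := by
  rwa [← ENNReal.div_le_iff h0 ht, ENNReal.div_self h0 ht] at h

section Grid

variable {n : ℕ} (t : Fin n → ℝ) {L : ℝ} (hL : 0 < L)

lemma cell_ae_eq_gridCube (q : ℕ × (Fin n → ℤ)) :
    (dyadicGrid t hL).cell q =ᵐ[volume] gridCube t L q := by
  have h := setOf_gridIdx_eq t hL q.1 q.2
  rw [CellSystem.cell, gridCube, closedCube_eq_Icc]
  change {x | gridIdx t L q.1 x = q.2} =ᵐ[volume] _
  rw [h]
  exact Measure.univ_pi_Ico_ae_eq_Icc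

lemma cell_subset_gridCube (q : ℕ × (Fin n → ℤ)) :
    (dyadicGrid t hL).cell q ⊆ gridCube t L q := by
  have h := setOf_gridIdx_eq t hL q.1 q.2
  change {x | gridIdx t L q.1 x = q.2} ⊆ _
  rw [h]
  intro x hx i
  have := hx i trivial
  exact ⟨this.1, this.2.le⟩

lemma avg_eq_cubeAvg (f : (Fin n → ℝ) → ℝ≥0∞) (q : ℕ × (Fin n → ℤ)) :
    (dyadicGrid t hL).avg f q = cubeAvg f (gridCube t L q) := by
  rw [CellSystem.avg, cubeAvg, setLIntegral_congr (cell_ae_eq_gridCube t hL q),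
    measure_congr (cell_ae_eq_gridCube t hL q)]

lemma avg_le_hlM (f : (Fin n → ℝ) → ℝ≥0∞) {q : ℕ × (Fin n → ℤ)} {x : Fin n → ℝ}
    (hx : x ∈ (dyadicGrid t hL).cell q) : (dyadicGrid t hL).avg f q ≤ hlM f x := by
  rw [avg_eq_cubeAvg]
  exact le_iSup₂_of_le _ (isCube_gridCube t hL q)
    (le_iSup_of_le (cell_subset_gridCube t hL q hx) le_rfl)

lemma lintegral_cell_ne_top {w : (Fin n → ℝ) → ℝ} (hw : LocallyIntegrable w volume)
    (q : ℕ × (Fin n → ℤ)) :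
    ∫⁻ x in (dyadicGrid t hL).cell q, ENNReal.ofReal (w x) ≠ ∞ := by
  rw [setLIntegral_congr (cell_ae_eq_gridCube t hL q), gridCube, closedCube_eq_Icc]
  exact ((hw.integrableOn_isCompact isCompact_Icc).lintegral_lt_top).ne

lemma lintegral_cell_ne_zero {w : (Fin n → ℝ) → ℝ} (hw : IsWeight w) (hm : Measurable w)
    (q : ℕ × (Fin n → ℤ)) :
    ∫⁻ x in (dyadicGrid t hL).cell q, ENNReal.ofReal (w x) ≠ 0 := by
  intro h
  rw [setLIntegral_eq_zero_iff ((dyadicGrid t hL).measurableSet_cell q) (by fun_prop)] at h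
  refine (dyadicGrid t hL).measure_cell_ne_zero q ?_
  rw [measure_eq_zero_iff_ae_notMem]
  filter_upwards [h, hw.2] with x hx hx0 hxq
  exact (ENNReal.ofReal_pos.2 hx0).ne' (hx hxq)

lemma ae_avg_le_a1Const {w : (Fin n → ℝ) → ℝ} (hw : IsWeight w) :
    ∀ᵐ x, ∀ q, x ∈ (dyadicGrid t hL).cell q →
      (dyadicGrid t hL).avg (fun y => ENNReal.ofReal (w y)) q ≤
        a1Const w * ENNReal.ofReal (w x) := by
  filter_upwards [hw.2, ENNReal.ae_le_essSup
    (fun x => hlM (fun y => ENNReal.ofReal (w y)) x / ENNReal.ofReal (w x))] with x hx h q hq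
  refine (avg_le_hlM t hL _ hq).trans ?_
  exact (ENNReal.div_le_iff (ENNReal.ofReal_pos.2 hx).ne' ENNReal.ofReal_ne_top).1 h

lemma lintegral_localMax_le {w : (Fin n → ℝ) → ℝ} (hw : IsWeight w) (hm : Measurable w)
    (p : ℕ × (Fin n → ℤ)) :
    ∫⁻ x in (dyadicGrid t hL).cell p,
        (dyadicGrid t hL).localMax (fun y => ENNReal.ofReal (w y)) p x ≤
      aInfConst w * ∫⁻ x in (dyadicGrid t hL).cell p, ENNReal.ofReal (w x) := by
  set Q := gridCube t L p with hQ
  have h1 : ∀ x, (dyadicGrid t hL).localMax (fun y => ENNReal.ofReal (w y)) p x ≤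
      hlM (Q.indicator fun y => ENNReal.ofReal (w y)) x := by
    intro x
    refine iSup_le fun q => iSup₂_le fun hq hx => ?_
    refine le_trans (le_of_eq ?_) (avg_le_hlM t hL _ hx)
    rw [CellSystem.avg, CellSystem.avg]
    congr 1
    refine setLIntegral_congr_fun ((dyadicGrid t hL).measurableSet_cell q) fun y hy => ?_
    exact (Set.indicator_of_mem (cell_subset_gridCube t hL p (hq.2 hy))
      (fun y => ENNReal.ofReal (w y))).symm
  have h2 : wMeas w Q = ∫⁻ x in (dyadicGrid t hL).cell p, ENNReal.ofReal (w x) :=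
    (setLIntegral_congr (cell_ae_eq_gridCube t hL p)).symm
  have h3 : (∫⁻ x in Q, hlM (Q.indicator fun y => ENNReal.ofReal (w y)) x) / wMeas w Q ≤
      aInfConst w :=
    le_iSup₂_of_le (f := fun (Q : Set (Fin n → ℝ)) (_ : IsCube Q) =>
      (∫⁻ x in Q, hlM (Q.indicator fun y => ENNReal.ofReal (w y)) x) / wMeas w Q)
      Q (isCube_gridCube t hL p) le_rfl
  rw [h2, ENNReal.div_le_iff (lintegral_cell_ne_zero t hL hw hm p)
    (lintegral_cell_ne_top t hL hw.1 p)] at h3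
  refine le_trans (lintegral_mono h1) (le_trans (le_of_eq ?_) h3)
  exact setLIntegral_congr (cell_ae_eq_gridCube t hL p)

lemma one_le_a1Const {w : (Fin n → ℝ) → ℝ} (hw : IsWeight w) (hm : Measurable w) :
    1 ≤ a1Const w := by
  let D := dyadicGrid (0 : Fin n → ℝ) one_pos
  refine ENNReal.one_le_of_le_mul (lintegral_cell_ne_zero (0 : Fin n → ℝ) one_pos hw hm (0, 0))
    (lintegral_cell_ne_top 0 one_pos hw.1 (0, 0)) ?_
  calc _ = ∫⁻ x in D.cell (0, 0), D.avg (fun y => ENNReal.ofReal (w y)) (0, 0) := by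
        rw [setLIntegral_const, D.avg_mul_measure]
    _ ≤ ∫⁻ x in D.cell (0, 0), a1Const w * ENNReal.ofReal (w x) := by
        refine setLIntegral_mono_ae (by fun_prop) ?_
        filter_upwards [ae_avg_le_a1Const 0 one_pos hw] with x hx hxq using hx _ hxq
    _ = _ := lintegral_const_mul _ (by fun_prop)

lemma one_le_aInfConst {w : (Fin n → ℝ) → ℝ} (hw : IsWeight w) (hm : Measurable w) :
    1 ≤ aInfConst w := by
  let D := dyadicGrid (0 : Fin n → ℝ) one_pos
  refine ENNReal.one_le_of_le_mul (lintegral_cell_ne_zero (0 : Fin n → ℝ) one_pos hw hm (0, 0))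
    (lintegral_cell_ne_top 0 one_pos hw.1 (0, 0)) ?_
  calc _ = ∫⁻ x in D.cell (0, 0), D.avg (fun y => ENNReal.ofReal (w y)) (0, 0) := by
        rw [setLIntegral_const, D.avg_mul_measure]
    _ ≤ ∫⁻ x in D.cell (0, 0), D.localMax (fun y => ENNReal.ofReal (w y)) (0, 0) x := by
        refine setLIntegral_mono' (D.measurableSet_cell _) fun x hx => ?_
        exact le_iSup₂_of_le _ (CellSystem.Below.refl D _) (le_iSup_of_le hx le_rfl)
    _ ≤ _ := lintegral_localMax_le 0 one_pos hw hm _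

end Grid

lemma ae_exists_lt_avg {n : ℕ} (t : Fin n → ℝ) {L : ℝ} (hL : 0 < L) {w : (Fin n → ℝ) → ℝ}
    (hw : IsWeight w) :
    ∀ᵐ x, ∀ (j : ℕ) (l : ℝ≥0∞), l < ENNReal.ofReal (w x) →
      ∃ q : ℕ × (Fin n → ℤ), j ≤ q.1 ∧ x ∈ (dyadicGrid t hL).cell q ∧
        l < (dyadicGrid t hL).avg (fun y => ENNReal.ofReal (w y)) q := by
  filter_upwards [IsUnifLocDoublingMeasure.ae_tendsto_average volume hw.1 1] with x hx j l hl
  have hlim : Filter.Tendsto (fun j : ℕ => L / 2 ^ j / 2) Filter.atTop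
      (nhdsWithin 0 (Set.Ioi 0)) := by
    refine tendsto_nhdsWithin_iff.2 ⟨?_, Filter.Eventually.of_forall fun j => ?_⟩
    · have := (tendsto_pow_atTop_nhds_zero_of_lt_one (r := (1 / 2 : ℝ)) (by norm_num)
        (by norm_num)).const_mul (L / 2)
      rw [mul_zero] at this
      refine this.congr fun j => ?_
      rw [one_div, inv_pow]
      ring
    · exact Set.mem_Ioi.2 (by positivity)
  have hball : ∀ j : ℕ, gridCube t L (j, gridIdx t L j x) = Metric.closedBall
      (fun i => t i + gridIdx t L j x i * (L / 2 ^ j) + L / 2 ^ j / 2) (L / 2 ^ j / 2) :=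
    fun j => closedCube_eq_closedBall _ (by positivity)
  have hmem : ∀ j : ℕ, x ∈ (dyadicGrid t hL).cell (j, gridIdx t L j x) := fun j => rfl
  have hx' := hx _ _ hlim (Filter.Eventually.of_forall fun j => by
    rw [one_mul, ← hball]
    exact cell_subset_gridCube t hL _ (hmem j))
  have havg : ∀ j : ℕ, ENNReal.ofReal (⨍ y in Metric.closedBall
      (fun i => t i + gridIdx t L j x i * (L / 2 ^ j) + L / 2 ^ j / 2) (L / 2 ^ j / 2), w y) =
      (dyadicGrid t hL).avg (fun y => ENNReal.ofReal (w y)) (j, gridIdx t L j x) := by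
    intro j
    have hvol : volume (gridCube t L (j, gridIdx t L j x)) ≠ 0 := by
      rw [← measure_congr (cell_ae_eq_gridCube t hL _)]
      exact (dyadicGrid t hL).measure_cell_ne_zero _
    have hvol' : volume (gridCube t L (j, gridIdx t L j x)) ≠ ∞ := by
      rw [← measure_congr (cell_ae_eq_gridCube t hL _)]
      exact (dyadicGrid t hL).measure_cell_ne_top _
    have hint : IntegrableOn w (gridCube t L (j, gridIdx t L j x)) := by
      rw [hball]
      exact hw.1.integrableOn_isCompact (isCompact_closedBall _ _)
    rw [avg_eq_cubeAvg, ← hball, setAverage_eq, smul_eq_mul, mul_comm, ← div_eq_mul_inv,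
      Measure.real, ENNReal.ofReal_div_of_pos (ENNReal.toReal_pos hvol hvol'),
      ofReal_integral_eq_lintegral_ofReal hint (ae_restrict_of_ae (hw.2.mono fun y hy => hy.le)),
      ENNReal.ofReal_toReal hvol']
    rfl
  have hx'' := (ENNReal.continuous_ofReal.tendsto _).comp hx'
  obtain ⟨i, hi, hij⟩ := ((hx''.eventually (lt_mem_nhds hl)).and
    (Filter.eventually_ge_atTop j)).exists
  refine ⟨(i, gridIdx t L i x), hij, hmem i, ?_⟩
  rw [← havg]
  exact hi

lemma exists_floor_eq {a h s r : ℝ} {j : ℕ} (hs : 0 < s) (hhs : 3 * h ≤ s)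
    (hr : 3 * r = 2 ^ j * s) :
    ∃ b : Bool, ∀ x, a ≤ x → x ≤ a + h →
      ⌊(x - bif b then r else 0) / s⌋ = ⌊(a - bif b then r else 0) / s⌋ := by
  by_contra! H
  have key : ∀ b : Bool, ∃ p : ℤ, (a - bif b then r else 0) < p * s ∧
      p * s ≤ a + h - bif b then r else 0 := by
    intro b
    obtain ⟨x, hx1, hx2, hx3⟩ := H b
    have hle : ⌊(a - bif b then r else 0) / s⌋ ≤ ⌊(x - bif b then r else 0) / s⌋ := by
      apply Int.floor_mono
      gcongr
    refine ⟨⌊(x - bif b then r else 0) / s⌋, ?_, ?_⟩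
    · rw [← div_lt_iff₀ hs]
      exact Int.floor_lt.1 (lt_of_le_of_ne hle hx3.symm)
    · have := Int.floor_le ((x - bif b then r else 0) / s)
      rw [le_div_iff₀ hs] at this
      linarith
  obtain ⟨p, hp1, hp2⟩ := key false
  obtain ⟨q, hq1, hq2⟩ := key true
  simp only [cond_true, cond_false, sub_zero] at hp1 hp2 hq1 hq2
  have h1 : (3 * (p - q) - 2 ^ j : ℝ) * s < 1 * s := by linarith
  have h2 : (-1 : ℝ) * s < (3 * (p - q) - 2 ^ j : ℝ) * s := by linarith
  have h1' := lt_of_mul_lt_mul_right h1 hs.le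
  have h2' := lt_of_mul_lt_mul_right h2 hs.le
  have h3 : 3 * (p - q) - 2 ^ j < (1 : ℤ) := by exact_mod_cast h1'
  have h4 : (-1 : ℤ) < 3 * (p - q) - 2 ^ j := by exact_mod_cast h2'
  have h5 : (3 : ℤ) ∣ 2 ^ j := ⟨p - q, by lia⟩
  have h6 := Int.prime_three.dvd_of_dvd_pow h5
  norm_num at h6

/-- The grids, with cubes of side at most `3 * 2 ^ N`, obtained from each other by translations by
`2 ^ N` in some of the coordinates. -/
noncomputable def shiftedGrid {n : ℕ} (N : ℕ) (α : Fin n → Bool) :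
    CellSystem (volume : Measure (Fin n → ℝ)) (2 ^ n) (Fin n → ℤ) :=
  dyadicGrid (fun i => bif α i then 2 ^ N else 0) (L := 3 * 2 ^ N) (by positivity)

lemma exists_closedCube_subset_cell {n : ℕ} (N : ℕ) (a : Fin n → ℝ) {h : ℝ} (hh : 0 < h)
    (hN : h ≤ 2 ^ N) :
    ∃ (α : Fin n → Bool) (q : ℕ × (Fin n → ℤ)), closedCube a h ⊆ (shiftedGrid N α).cell q ∧
      volume ((shiftedGrid N α).cell q) ≤ 6 ^ n * volume (closedCube a h) := by
  obtain ⟨j, hj1, hj2⟩ := exists_nat_pow_near (x := 2 ^ N / h) (y := 2)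
    ((one_le_div₀ hh).2 hN) one_lt_two
  rw [le_div_iff₀ hh] at hj1
  rw [div_lt_iff₀ hh] at hj2
  have h2j : (0 : ℝ) < 2 ^ j := by positivity
  have hs : (0 : ℝ) < 3 * 2 ^ N / 2 ^ j := by positivity
  have hhs : 3 * h ≤ 3 * 2 ^ N / 2 ^ j := by
    rw [le_div_iff₀ h2j]; linarith
  have hhs' : 3 * 2 ^ N / 2 ^ j ≤ 6 * h := by
    rw [div_le_iff₀ h2j]; rw [pow_succ] at hj2; linarith
  choose α hα using fun i => exists_floor_eq (a := a i) (r := 2 ^ N) (j := j) hs hhs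
    (by field_simp)
  refine ⟨α, (j, gridIdx (fun i => bif α i then 2 ^ N else 0) (3 * 2 ^ N) j a), ?_, ?_⟩
  · intro x hx
    exact funext fun i => hα i (x i) (hx i).1 (hx i).2
  · rw [volume_closedCube, ← mul_pow, ← ENNReal.ofReal_ofNat 6, ← ENNReal.ofReal_mul (by norm_num)]
    refine (volume_setOf_gridIdx_eq _ (by positivity) j _).trans_le ?_
    gcongr

lemma exists_cubeAvg_le_avg {n : ℕ} (N : ℕ) (a : Fin n → ℝ) {h : ℝ} (hh : 0 < h) (hN : h ≤ 2 ^ N)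
    (g : (Fin n → ℝ) → ℝ≥0∞) :
    ∃ (α : Fin n → Bool) (q : ℕ × (Fin n → ℤ)), closedCube a h ⊆ (shiftedGrid N α).cell q ∧
      cubeAvg g (closedCube a h) ≤ 6 ^ n * (shiftedGrid N α).avg g q := by
  obtain ⟨α, q, hq, hvol⟩ := exists_closedCube_subset_cell N a hh hN
  refine ⟨α, q, hq, ?_⟩
  have h0 : volume (closedCube a h) ≠ 0 := by
    rw [volume_closedCube]; exact pow_ne_zero _ (ENNReal.ofReal_pos.2 hh).ne'
  have ht : volume (closedCube a h) ≠ ∞ := by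
    rw [volume_closedCube]; exact ENNReal.pow_ne_top ENNReal.ofReal_ne_top
  rw [cubeAvg, ENNReal.div_le_iff h0 ht]
  calc _ ≤ ∫⁻ x in (shiftedGrid N α).cell q, g x := lintegral_mono_set hq
    _ = (shiftedGrid N α).avg g q * volume ((shiftedGrid N α).cell q) :=
        ((shiftedGrid N α).avg_mul_measure g q).symm
    _ ≤ (shiftedGrid N α).avg g q * (6 ^ n * volume (closedCube a h)) := by gcongr
    _ = _ := by ring

lemma lintegral_shiftedGrid_le {n : ℕ} (N : ℕ) (α : Fin n → Bool) {u v : (Fin n → ℝ) → ℝ}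
    (hu : IsWeight u) (hv : IsWeight v) (hum : Measurable u) (hvm : Measurable v)
    (hu1 : a1Const u ≠ ∞) (hv1 : a1Const v ≠ ∞) {G : (Fin n → ℝ) → ℝ≥0∞} (hG : Measurable G) :
    ∫⁻ x in {x | ∃ q, x ∈ (shiftedGrid N α).cell q ∧
        ENNReal.ofReal (v x) < (shiftedGrid N α).avg G q},
        ENNReal.ofReal (u x) * ENNReal.ofReal (v x) ≤
      9 * (2 * 2 ^ n) ^ 2 * (a1Const u * aInfConst v *
        (a1Const u + 1 + ENNReal.ofReal (Real.log (a1Const v).toReal))) *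
          ∫⁻ x, G x * ENNReal.ofReal (u x) :=
  (shiftedGrid N α).lintegral_lt_maxFn_le (one_le_pow₀ one_le_two)
    (ENNReal.pow_ne_top (by simp)) hG hum.ennreal_ofReal hvm.ennreal_ofReal
    (one_le_a1Const hu hum) hu1 (one_le_aInfConst hv hvm) hv1
    (lintegral_cell_ne_top _ _ hu.1) (lintegral_cell_ne_top _ _ hv.1)
    (hv.2.mono fun x hx => (ENNReal.ofReal_pos.2 hx).ne')
    (Filter.Eventually.of_forall fun x => ENNReal.ofReal_ne_top)
    (ae_avg_le_a1Const _ _ hu) (ae_avg_le_a1Const _ _ hv)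
    (lintegral_localMax_le _ _ hv hvm) (ae_exists_lt_avg _ _ hv)

lemma CellSystem.avg_const_mul {X κ : Type*} [MeasurableSpace X] {μ : Measure X} {N : ℝ≥0∞}
    (D : CellSystem μ N κ) {g : X → ℝ≥0∞} (hg : Measurable g) (c : ℝ≥0∞) (q : ℕ × κ) :
    D.avg (fun x => c * g x) q = c * D.avg g q := by
  rw [avg, avg, lintegral_const_mul _ hg, mul_div_assoc]

lemma setLIntegral_iUnion_le_of_monotone {X : Type*} [MeasurableSpace X] {μ : Measure X} [SFinite μ]
    {g : X → ℝ≥0∞} {E : ℕ → Set X} (hE : Monotone E) {b : ℝ≥0∞}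
    (h : ∀ i, ∫⁻ x in E i, g x ∂μ ≤ b) : ∫⁻ x in ⋃ i, E i, g x ∂μ ≤ b := by
  rw [← withDensity_apply', hE.measure_iUnion]
  exact iSup_le fun i => (withDensity_apply' _ _).trans_le (h i)

lemma lintegral_lt_hlM_le {n : ℕ} {u v : (Fin n → ℝ) → ℝ}
    (hu : IsWeight u) (hv : IsWeight v) (hum : Measurable u) (hvm : Measurable v)
    (hu1 : a1Const u ≠ ∞) (hv1 : a1Const v ≠ ∞) {g : (Fin n → ℝ) → ℝ≥0∞} (hg : Measurable g) :
    ∫⁻ x in {x | ENNReal.ofReal (v x) < hlM g x}, ENNReal.ofReal (u x) * ENNReal.ofReal (v x) ≤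
      9 * 48 ^ n * 4 * (a1Const u * aInfConst v *
        (a1Const u + 1 + ENNReal.ofReal (Real.log (a1Const v).toReal))) *
          ∫⁻ x, g x * ENNReal.ofReal (u x) := by
  set E : ℕ → Set (Fin n → ℝ) := fun N => {x | ∃ (a : Fin n → ℝ) (h : ℝ), 0 < h ∧ h ≤ 2 ^ N ∧
    x ∈ closedCube a h ∧ ENNReal.ofReal (v x) < cubeAvg g (closedCube a h)} with hE
  have hmono : Monotone E := by
    rintro M N hMN x ⟨a, h, hh, hM, hx⟩
    exact ⟨a, h, hh, hM.trans (pow_le_pow_right₀ one_le_two hMN), hx⟩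
  have hsub : {x | ENNReal.ofReal (v x) < hlM g x} ⊆ ⋃ N, E N := by
    intro x hx
    simp only [Set.mem_ofPred_eq, hlM, lt_iSup_iff] at hx
    obtain ⟨Q, ⟨a, h, hh, rfl⟩, hxQ, hlt⟩ := hx
    obtain ⟨N, hN⟩ := pow_unbounded_of_one_lt h one_lt_two
    exact Set.mem_iUnion.2 ⟨N, a, h, hh, hN.le, hxQ, hlt⟩
  refine (lintegral_mono_set hsub).trans (setLIntegral_iUnion_le_of_monotone hmono fun N => ?_)
  have hsub' : E N ⊆ ⋃ α : Fin n → Bool, {x | ∃ q, x ∈ (shiftedGrid N α).cell q ∧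
      ENNReal.ofReal (v x) < (shiftedGrid N α).avg (fun y => 6 ^ n * g y) q} := by
    rintro x ⟨a, h, hh, hN, hx, hlt⟩
    obtain ⟨α, q, hq, havg⟩ := exists_cubeAvg_le_avg N a hh hN g
    refine Set.mem_iUnion.2 ⟨α, q, hq hx, hlt.trans_le ?_⟩
    rwa [CellSystem.avg_const_mul _ hg]
  calc _ ≤ _ := lintegral_mono_set hsub'
    _ ≤ _ := lintegral_iUnion_le _ _
    _ ≤ ∑' α : Fin n → Bool, _ := ENNReal.tsum_le_tsum fun α =>
        lintegral_shiftedGrid_le N α hu hv hum hvm hu1 hv1 (hg.const_mul _)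
    _ = 2 ^ n * (9 * (2 * 2 ^ n) ^ 2 * (a1Const u * aInfConst v *
        (a1Const u + 1 + ENNReal.ofReal (Real.log (a1Const v).toReal))) *
          (6 ^ n * ∫⁻ x, g x * ENNReal.ofReal (u x))) := by
        simp only [mul_assoc (6 ^ n : ℝ≥0∞)]
        rw [lintegral_const_mul _ (by fun_prop), tsum_fintype]
        simp
    _ = _ := by
        have h48 : (48 : ℝ≥0∞) ^ n = 2 ^ n * (2 ^ n) ^ 2 * 6 ^ n := by
          rw [← pow_mul, mul_comm n 2, pow_mul, ← mul_pow, ← mul_pow]; norm_num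
        rw [h48]; ring

lemma cubeAvg_congr_ae {n : ℕ} {f g : (Fin n → ℝ) → ℝ≥0∞} (h : f =ᵐ[volume] g)
    (Q : Set (Fin n → ℝ)) : cubeAvg f Q = cubeAvg g Q := by
  rw [cubeAvg, cubeAvg, lintegral_congr_ae (ae_restrict_of_ae h)]

lemma hlM_const_mul {n : ℕ} {f : (Fin n → ℝ) → ℝ≥0∞} (hf : Measurable f) (c : ℝ≥0∞)
    (x : Fin n → ℝ) : hlM (fun y => c * f y) x = c * hlM f x := by
  simp only [hlM, cubeAvg, lintegral_const_mul _ hf, mul_div_assoc, ENNReal.mul_iSup]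

lemma hlM_congr_ae {n : ℕ} {f g : (Fin n → ℝ) → ℝ≥0∞} (h : f =ᵐ[volume] g) : hlM f = hlM g := by
  funext x
  simp only [hlM, cubeAvg_congr_ae h]

lemma a1Const_congr_ae {n : ℕ} {w w' : (Fin n → ℝ) → ℝ} (h : w =ᵐ[volume] w') :
    a1Const w = a1Const w' := by
  have h' := h.fun_comp ENNReal.ofReal
  have hM := hlM_congr_ae h'
  refine essSup_congr_ae ?_
  filter_upwards [h] with x hx
  rw [hx]
  exact congrArg (fun M => M x / ENNReal.ofReal (w' x)) hM

lemma wMeas_congr_ae {n : ℕ} {w w' : (Fin n → ℝ) → ℝ} (h : w =ᵐ[volume] w')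
    {E E' : Set (Fin n → ℝ)} (hE : E =ᵐ[volume] E') : wMeas w E = wMeas w' E' := by
  rw [wMeas, wMeas, setLIntegral_congr hE]
  exact lintegral_congr_ae (ae_restrict_of_ae (h.fun_comp ENNReal.ofReal))

lemma aInfConst_congr_ae {n : ℕ} {w w' : (Fin n → ℝ) → ℝ} (h : w =ᵐ[volume] w') :
    aInfConst w = aInfConst w' := by
  have hM : ∀ Q : Set (Fin n → ℝ), hlM (Q.indicator fun y => ENNReal.ofReal (w y)) =
      hlM (Q.indicator fun y => ENNReal.ofReal (w' y)) := fun Q => by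
    refine hlM_congr_ae ?_
    filter_upwards [h] with x hx
    by_cases hxQ : x ∈ Q <;> simp [hxQ, hx]
  have hw : ∀ Q, wMeas w Q = wMeas w' Q := fun Q => wMeas_congr_ae h (Filter.EventuallyEq.refl _ _)
  simp only [aInfConst, hM, hw]

lemma IsWeight.congr_ae {n : ℕ} {w w' : (Fin n → ℝ) → ℝ} (hw : IsWeight w)
    (h : w =ᵐ[volume] w') : IsWeight w' := by
  refine ⟨hw.1.congr h, ?_⟩
  filter_upwards [h, hw.2] with x hx hx'
  rwa [← hx]

lemma wMeas_lt_hlMR_div_le {n : ℕ} {u v : (Fin n → ℝ) → ℝ}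
    (hu : IsWeight u) (hv : IsWeight v) (hum : Measurable u) (hvm : Measurable v)
    (hu1 : a1Const u ≠ ∞) (hv1 : a1Const v ≠ ∞) {f : (Fin n → ℝ) → ℝ} (hf : Measurable f)
    {t : ℝ≥0} (ht : 0 < t) :
    t * wMeas (fun x => u x * v x)
        {x | (t : ℝ≥0∞) < hlMR (fun y => f y * v y) x / ENNReal.ofReal (v x)} ≤
      9 * 48 ^ n * 4 * (a1Const u * aInfConst v *
        (a1Const u + 1 + ENNReal.ofReal (Real.log (a1Const v).toReal))) *
          l1Norm f (fun x => u x * v x) := by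
  have ht0 : (t : ℝ≥0∞) ≠ 0 := by exact_mod_cast ht.ne'
  have huv : ∀ᵐ x, ENNReal.ofReal (u x * v x) = ENNReal.ofReal (u x) * ENNReal.ofReal (v x) :=
    hu.2.mono fun x hx => ENNReal.ofReal_mul hx.le
  set F : (Fin n → ℝ) → ℝ≥0∞ := fun y => ENNReal.ofReal |f y * v y| with hF
  have hFm : Measurable F := by fun_prop
  have hsub : {x | (t : ℝ≥0∞) < hlMR (fun y => f y * v y) x / ENNReal.ofReal (v x)} ⊆
      {x | ENNReal.ofReal (v x) < hlM (fun y => (t : ℝ≥0∞)⁻¹ * F y) x} := by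
    intro x hx
    have hx' : t * ENNReal.ofReal (v x) < hlM F x := ENNReal.mul_lt_of_lt_div hx
    rw [Set.mem_ofPred_eq, hlM_const_mul hFm, ← ENNReal.mul_lt_mul_iff_right ht0
      ENNReal.coe_ne_top, ← mul_assoc, ENNReal.mul_inv_cancel ht0 ENNReal.coe_ne_top, one_mul]
    exact hx'
  have hint : ∫⁻ x, (t : ℝ≥0∞)⁻¹ * F x * ENNReal.ofReal (u x) =
      (t : ℝ≥0∞)⁻¹ * l1Norm f (fun x => u x * v x) := by
    simp only [mul_assoc]
    rw [lintegral_const_mul _ (by fun_prop), l1Norm]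
    congr 1
    refine lintegral_congr_ae ?_
    filter_upwards [huv, hv.2] with x hx hvx
    simp only [hF]
    rw [hx, abs_mul, ENNReal.ofReal_mul (abs_nonneg _), abs_of_pos hvx]
    ring
  have key := lintegral_lt_hlM_le hu hv hum hvm hu1 hv1 (hFm.const_mul (t : ℝ≥0∞)⁻¹)
  rw [hint] at key
  calc _ ≤ t * ∫⁻ x in {x | ENNReal.ofReal (v x) < hlM (fun y => (t : ℝ≥0∞)⁻¹ * F y) x},
        ENNReal.ofReal (u x) * ENNReal.ofReal (v x) := by
        gcongr
        rw [wMeas, lintegral_congr_ae (ae_restrict_of_ae huv)]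
        exact lintegral_mono_set hsub
    _ ≤ _ := mul_le_mul_right key _
    _ = _ := by
        rw [mul_left_comm, ← mul_assoc (t : ℝ≥0∞), ENNReal.mul_inv_cancel ht0 ENNReal.coe_ne_top,
          one_mul]

lemma wkNorm_congr_ae {n : ℕ} {g g' : (Fin n → ℝ) → ℝ≥0∞} {σ σ' : (Fin n → ℝ) → ℝ}
    (hg : g =ᵐ[volume] g') (hσ : σ =ᵐ[volume] σ') : wkNorm g σ = wkNorm g' σ' := by
  unfold wkNorm
  congr! 4 with t ht
  refine wMeas_congr_ae hσ ?_
  filter_upwards [hg] with x hx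
  exact congrArg (fun y => (t : ℝ≥0∞) < y) hx

lemma l1Norm_congr_ae {n : ℕ} (f : (Fin n → ℝ) → ℝ) {σ σ' : (Fin n → ℝ) → ℝ}
    (hσ : σ =ᵐ[volume] σ') : l1Norm f σ = l1Norm f σ' := by
  refine lintegral_congr_ae ?_
  filter_upwards [hσ] with x hx
  rw [hx]

/-- **Quantitative mixed weak-type bound for `u, v ∈ A₁`.**
`‖M(fv)/v‖_{L^{1,∞}(uv)} ≤ c_n [u]_{A₁}[v]_{A_∞}([u]_{A₁}[v]_{A_∞} + 1 + log [v]_{A₁}) ‖f‖_{L¹(uv)}`. -/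
theorem quantitative_mixed_bound_A1 (n : ℕ) :
    ∃ c : ℝ≥0, 0 < c ∧
      ∀ u v : (Fin n → ℝ) → ℝ, IsWeight u → IsWeight v →
        a1Const u ≠ ∞ → a1Const v ≠ ∞ →
        ∀ f : (Fin n → ℝ) → ℝ, Measurable f →
          l1Norm f (fun x => u x * v x) ≠ ∞ →
          wkNorm (fun x => hlMR (fun y => f y * v y) x / ENNReal.ofReal (v x))
              (fun x => u x * v x) ≤
            (c : ℝ≥0∞) * a1Const u * aInfConst v *
              (a1Const u * aInfConst v + 1 +
                ENNReal.ofReal (Real.log (a1Const v).toReal)) *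
              l1Norm f (fun x => u x * v x) := by
  refine ⟨9 * 48 ^ n * 4, by positivity, fun u v hu hv hu1 hv1 f hf _ => ?_⟩
  obtain ⟨u', hum, huu⟩ := hu.1.aestronglyMeasurable.aemeasurable
  obtain ⟨v', hvm, hvv⟩ := hv.1.aestronglyMeasurable.aemeasurable
  have hu' := hu.congr_ae huu
  have hv' := hv.congr_ae hvv
  have huv : (fun x => u x * v x) =ᵐ[volume] fun x => u' x * v' x := huu.mul hvv
  have hM : hlMR (fun y => f y * v y) = hlMR (fun y => f y * v' y) := by
    refine hlM_congr_ae ?_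
    filter_upwards [hvv] with x hx
    rw [hx]
  have hquot : (fun x => hlMR (fun y => f y * v y) x / ENNReal.ofReal (v x)) =ᵐ[volume]
      fun x => hlMR (fun y => f y * v' y) x / ENNReal.ofReal (v' x) := by
    filter_upwards [hvv] with x hx
    rw [hM, hx]
  rw [wkNorm_congr_ae hquot huv, l1Norm_congr_ae f huv, aInfConst_congr_ae hvv]
  rw [a1Const_congr_ae huu] at hu1 ⊢
  rw [a1Const_congr_ae hvv] at hv1 ⊢
  refine iSup₂_le fun t ht =>
    (wMeas_lt_hlMR_div_le hu' hv' hum hvm hu1 hv1 hf ht).trans ?_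
  push_cast
  rw [mul_assoc _ (a1Const u'), mul_assoc _ (a1Const u' * aInfConst v')]
  gcongr
  exact le_mul_of_one_le_right' (one_le_aInfConst hv' hvm)
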